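/- arXiv:1508.00098 — 5 statements merged into one kernel-verified Lean document; each statement's English description precedes it below -/
import Mathlib

section
/- For every v ∈ {10, 13, 16, 19, 22, 25, 28, 31, 34, 40, 43, 58, 67, 79, 94, 103} there exists a super-simple 2-(v,4,2) directed design whose every defining set contains at least half of the total number of blocks. -/
/-- A `t-(v,k,λ)` directed design on the point type `X`: a collection of
blocks, each an ordered `k`-tuple (a duplicate-free list of length `k`) of
points, such that every ordered `t`-tuple of distinct points occurs, in the
given order (i.e. as a sublist), in exactly `lam` blocks. -/
structure DirectedDesign (X : Type*) [DecidableEq X] (t k lam : ℕ) where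
  blocks : Multiset (List X)
  len : ∀ b ∈ blocks, b.length = k
  nodup : ∀ b ∈ blocks, b.Nodup
  covers : ∀ s : List X, s.length = t → s.Nodup →
    blocks.countP (fun b => s.Sublist b) = lam

/-- A directed design is super-simple if it has no repeated blocks and any two
distinct blocks have at most 2 points in common. -/
def DirectedDesign.SuperSimple {X : Type*} [DecidableEq X] {t k lam : ℕ}
    (D : DirectedDesign X t k lam) : Prop :=
  D.blocks.Nodup ∧
    ∀ b₁ ∈ D.blocks, ∀ b₂ ∈ D.blocks, b₁ ≠ b₂ →
      (b₁.toFinset ∩ b₂.toFinset).card ≤ 2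

/-- `S` is a defining set of the directed design `D` if `S` is a
subcollection of the blocks of `D` and `D.blocks` is the unique block
collection of a `t-(v,k,λ)` directed design on the same point set
containing `S`. -/
def DirectedDesign.IsDefiningSet {X : Type*} [DecidableEq X] {t k lam : ℕ}
    (D : DirectedDesign X t k lam) (S : Multiset (List X)) : Prop :=
  S ≤ D.blocks ∧
    ∀ D' : DirectedDesign X t k lam, S ≤ D'.blocks → D'.blocks = D.blocks

/-- Every defining set of `D` contains at least half of the blocks
(the paper's condition `d ≥ 1/2`). -/
def DirectedDesign.DefiningHalf {X : Type*} [DecidableEq X] {t k lam : ℕ}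
    (D : DirectedDesign X t k lam) : Prop :=
  ∀ S : Multiset (List X), D.IsDefiningSet S →
    Multiset.card D.blocks ≤ 2 * Multiset.card S

/-- A `(v,k,t)` directed trade `T = T₁ - T₂`: two disjoint nonempty
collections of blocks of the same volume such that every ordered `t`-tuple
of distinct points is covered by equally many blocks of `T₁` as of `T₂`. -/
structure DirectedTrade (X : Type*) [DecidableEq X] (k t : ℕ) where
  pos : Multiset (List X)
  neg : Multiset (List X)
  pos_len : ∀ b ∈ pos, b.length = k
  pos_nodup : ∀ b ∈ pos, b.Nodup
  neg_len : ∀ b ∈ neg, b.length = k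
  neg_nodup : ∀ b ∈ neg, b.Nodup
  disjoint : Disjoint pos neg
  pos_ne : pos ≠ 0
  card_eq : Multiset.card pos = Multiset.card neg
  balanced : ∀ s : List X, s.length = t → s.Nodup →
    pos.countP (fun b => s.Sublist b) = neg.countP (fun b => s.Sublist b)

/-- A `(k,λ)` directed group divisible design (DGDD) with the given group set
`groups`: blocks are ordered `k`-tuples of distinct points meeting each group
in at most one point, and every ordered pair of distinct points from
different groups occurs, in order, in exactly `lam` blocks. -/
structure DGDD (X : Type*) [DecidableEq X] (groups : Finset (Finset X))
    (k lam : ℕ) where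
  blocks : Multiset (List X)
  len : ∀ b ∈ blocks, b.length = k
  nodup : ∀ b ∈ blocks, b.Nodup
  transverse : ∀ b ∈ blocks, ∀ G ∈ groups, (b.toFinset ∩ G).card ≤ 1
  covers : ∀ x y : X, x ≠ y → (∀ G ∈ groups, ¬(x ∈ G ∧ y ∈ G)) →
    blocks.countP (fun b => [x, y].Sublist b) = lam

/-- A DGDD is super-simple if it has no repeated blocks and any two distinct
blocks have at most 2 points in common. -/
def DGDD.SuperSimple {X : Type*} [DecidableEq X] {groups : Finset (Finset X)}
    {k lam : ℕ} (D : DGDD X groups k lam) : Prop :=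
  D.blocks.Nodup ∧
    ∀ b₁ ∈ D.blocks, ∀ b₂ ∈ D.blocks, b₁ ≠ b₂ →
      (b₁.toFinset ∩ b₂.toFinset).card ≤ 2

/-- `S` is a defining set of the DGDD `D` if `S` is a subcollection of the
blocks of `D` and `D.blocks` is the unique block collection of a
`(k,λ)`-DGDD with the same groups containing `S`. -/
def DGDD.IsDefiningSet {X : Type*} [DecidableEq X] {groups : Finset (Finset X)}
    {k lam : ℕ} (D : DGDD X groups k lam) (S : Multiset (List X)) : Prop :=
  S ≤ D.blocks ∧
    ∀ D' : DGDD X groups k lam, S ≤ D'.blocks → D'.blocks = D.blocks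

/-- Every defining set of the DGDD `D` contains at least half of the blocks. -/
def DGDD.DefiningHalf {X : Type*} [DecidableEq X] {groups : Finset (Finset X)}
    {k lam : ℕ} (D : DGDD X groups k lam) : Prop :=
  ∀ S : Multiset (List X), D.IsDefiningSet S →
    Multiset.card D.blocks ≤ 2 * Multiset.card S

/-- A (undirected) `(K,λ)` group divisible design with the given group set
`groups`: blocks are subsets of the point set with sizes in `K` meeting each
group in at most one point, and every pair of distinct points from different
groups lies in exactly `lam` blocks. -/
structure GDD (X : Type*) [DecidableEq X] (groups : Finset (Finset X))
    (K : Finset ℕ) (lam : ℕ) where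
  blocks : Multiset (Finset X)
  size_mem : ∀ b ∈ blocks, b.card ∈ K
  transverse : ∀ b ∈ blocks, ∀ G ∈ groups, (b ∩ G).card ≤ 1
  covers : ∀ x y : X, x ≠ y → (∀ G ∈ groups, ¬(x ∈ G ∧ y ∈ G)) →
    blocks.countP (fun b => x ∈ b ∧ y ∈ b) = lam

/-- `groups` is a partition of the point type `X`: every point lies in
exactly one group. -/
def IsGroupPartition {X : Type*} (groups : Finset (Finset X)) : Prop :=
  ∀ x : X, ∃! G, G ∈ groups ∧ x ∈ G

/-! ### Cyclic constructions -/

/-- A base block `(a,b,c,d)` together with a trade partner: the index `j` of another base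
block, and positions `p`, `q` such that the adjacent pair at position `p` of this block and
the adjacent pair at position `q` of base block `j` have opposite differences. -/
structure CDEntry where
  a : ℕ
  b : ℕ
  c : ℕ
  d : ℕ
  j : ℕ
  p : ℕ
  q : ℕ

/-- The point in position `k`. -/
def CDEntry.pt (e : CDEntry) : ℕ → ℕ
  | 0 => e.a
  | 1 => e.b
  | 2 => e.c
  | _ => e.d

/-- Subtraction modulo `v`. -/
def cdSub (v x y : ℕ) : ℕ := (v - y + x) % v

/-- All ordered triples of distinct positions. -/
def cdTriples : List (ℕ × ℕ × ℕ) :=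
  [(0,1,2), (0,1,3), (0,2,1), (0,2,3), (0,3,1), (0,3,2),
   (1,0,2), (1,0,3), (1,2,0), (1,2,3), (1,3,0), (1,3,2),
   (2,0,1), (2,0,3), (2,1,0), (2,1,3), (2,3,0), (2,3,1),
   (3,0,1), (3,0,2), (3,1,0), (3,1,2), (3,2,0), (3,2,1)]

/-- Code of the translation class of an ordered triple. -/
def cdCode (v : ℕ) (e : CDEntry) (t : ℕ × ℕ × ℕ) : ℕ :=
  cdSub v (e.pt t.2.1) (e.pt t.1) * v + cdSub v (e.pt t.2.2) (e.pt t.1)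

/-- Duplicate-freeness test with a bit mask. -/
def cdFresh : List ℕ → ℕ → Bool
  | [], _ => true
  | x :: xs, m => !(m.testBit x) && cdFresh xs (m ||| 2 ^ x)

/-- Number of ordered pairs of positions of `e` with difference `d`. -/
def cdCount (v : ℕ) (e : CDEntry) (d : ℕ) : ℕ :=
  (if cdSub v e.b e.a = d then 1 else 0) + (if cdSub v e.c e.a = d then 1 else 0) +
  (if cdSub v e.d e.a = d then 1 else 0) + (if cdSub v e.c e.b = d then 1 else 0) +
  (if cdSub v e.d e.b = d then 1 else 0) + (if cdSub v e.d e.c = d then 1 else 0)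

/-- The points of `e` are distinct and smaller than `v`. -/
def cdGood (v : ℕ) (e : CDEntry) : Prop :=
  (e.a < v ∧ e.b < v ∧ e.c < v ∧ e.d < v) ∧
  (e.a ≠ e.b ∧ e.a ≠ e.c ∧ e.a ≠ e.d ∧ e.b ≠ e.c ∧ e.b ≠ e.d ∧ e.c ≠ e.d)

instance (v : ℕ) (e : CDEntry) : Decidable (cdGood v e) := by
  unfold cdGood; infer_instance

/-- The trade partner of `e` is a legal one. -/
def cdPartner (v : ℕ) (L : List CDEntry) (e : CDEntry) : Prop :=
  e.p < 3 ∧ e.q < 3 ∧ ∃ h : e.j < L.length,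
    cdSub v (e.pt (e.p + 1)) (e.pt e.p) = cdSub v (L[e.j].pt e.q) (L[e.j].pt (e.q + 1))

instance (v : ℕ) (L : List CDEntry) (e : CDEntry) : Decidable (cdPartner v L e) := by
  unfold cdPartner; infer_instance

/-- The complete test for a family of base blocks. -/
def cdCheck (v : ℕ) (L : List CDEntry) : Bool :=
  decide (0 < v) && L.all (fun e => decide (cdGood v e)) &&
  (List.range v).all (fun d => decide (d = 0) || decide ((L.map (fun e => cdCount v e d)).sum = 2)) &&
  cdFresh (L.flatMap (fun e => cdTriples.map (cdCode v e))) 0 &&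
  L.all (fun e => decide (cdPartner v L e)) && cdFresh (L.map CDEntry.j) 0

theorem cdFresh_nodup (l : List ℕ) : ∀ m : ℕ, cdFresh l m = true →
    l.Nodup ∧ ∀ x ∈ l, m.testBit x = false := by
  induction l with
  | nil => intro m _; simp
  | cons y ys ih =>
    intro m h
    simp only [cdFresh, Bool.and_eq_true, Bool.not_eq_true'] at h
    obtain ⟨h1, h2⟩ := h
    obtain ⟨h3, h4⟩ := ih _ h2
    have h5 : ∀ x ∈ ys, m.testBit x = false ∧ x ≠ y := by
      intro x hx
      have := h4 x hx
      rw [Nat.testBit_or, Nat.testBit_two_pow] at this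
      simp only [Bool.or_eq_false_iff, decide_eq_false_iff_not] at this
      exact ⟨this.1, fun h => this.2 h.symm⟩
    refine ⟨List.nodup_cons.2 ⟨fun hy => (h5 y hy).2 rfl, h3⟩, ?_⟩
    intro x hx
    rcases List.mem_cons.1 hx with rfl | hx
    · exact h1
    · exact (h5 x hx).1

section Lists

variable {X : Type*} [DecidableEq X]

/-- Indicator that `[x, y]` is a sublist of a four-element list, as a sum. -/
theorem cd_ind (x y a b c d : X) (hn : [a, b, c, d].Nodup) :
    (if [x, y].Sublist [a, b, c, d] then 1 else 0 : ℕ) =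
      (if a = x ∧ b = y then 1 else 0) + (if a = x ∧ c = y then 1 else 0) +
      (if a = x ∧ d = y then 1 else 0) + (if b = x ∧ c = y then 1 else 0) +
      (if b = x ∧ d = y then 1 else 0) + (if c = x ∧ d = y then 1 else 0) := by
  have key : [x, y].Sublist [a, b, c, d] ↔ (a = x ∧ b = y) ∨ (a = x ∧ c = y) ∨ (a = x ∧ d = y) ∨
      (b = x ∧ c = y) ∨ (b = x ∧ d = y) ∨ (c = x ∧ d = y) := by
    simp only [List.sublist_cons_iff, List.sublist_nil]
    constructor
    · intro h
      grind
    · intro h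
      rcases h with ⟨rfl, rfl⟩ | ⟨rfl, rfl⟩ | ⟨rfl, rfl⟩ | ⟨rfl, rfl⟩ | ⟨rfl, rfl⟩ | ⟨rfl, rfl⟩ <;> simp
  simp only [List.nodup_cons, List.mem_cons, List.not_mem_nil, or_false, not_or] at hn
  obtain ⟨⟨h1, h2, h3⟩, ⟨h4, h5⟩, h6, -⟩ := hn
  simp only [key]
  have h6' : d ≠ c := fun h => h6 h.symm
  by_cases ha : a = x
  · subst ha
    have : b ≠ a := Ne.symm h1
    have : c ≠ a := Ne.symm h2
    have : d ≠ a := Ne.symm h3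
    by_cases hb : b = y
    · subst hb; simp_all [Ne.symm]
    · by_cases hc : c = y
      · subst hc; simp_all
      · simp_all
  · by_cases hb : b = x
    · subst hb
      have : c ≠ b := Ne.symm h4
      have : d ≠ b := Ne.symm h5
      by_cases hc : c = y
      · subst hc; simp_all
      · simp_all
    · simp_all

/-- Exchange two adjacent elements of a four-element list. -/
def cdSwap : ℕ → List X → List X
  | 0, [a, b, c, d] => [b, a, c, d]
  | 1, [a, b, c, d] => [a, c, b, d]
  | 2, [a, b, c, d] => [a, b, d, c]
  | _, l => l

theorem cdSwap_perm (p : ℕ) (l : List X) : (cdSwap p l).Perm l := by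
  unfold cdSwap
  split
  · exact List.Perm.swap _ _ _
  · exact (List.Perm.swap _ _ _).cons _
  · exact ((List.Perm.swap _ _ _).cons _).cons _
  · exact List.Perm.refl _

/-- Effect of an exchange on the covered ordered pairs. -/
theorem cdSwap_ind (f : ℕ → X) (hn : [f 0, f 1, f 2, f 3].Nodup) (p : ℕ) (hp : p < 3) (x y : X) :
    (if [x, y].Sublist (cdSwap p [f 0, f 1, f 2, f 3]) then 1 else 0 : ℕ) +
        (if f p = x ∧ f (p + 1) = y then 1 else 0) =
      (if [x, y].Sublist [f 0, f 1, f 2, f 3] then 1 else 0) +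
        (if f (p + 1) = x ∧ f p = y then 1 else 0) := by
  have hn' := (cdSwap_perm p _).nodup_iff.2 hn
  rw [cd_ind _ _ _ _ _ _ hn]
  interval_cases p <;> simp only [cdSwap] at hn' ⊢ <;> rw [cd_ind _ _ _ _ _ _ hn'] <;>
    simp only [Nat.reduceAdd] <;> ring

theorem cdSwap_ne (f : ℕ → X) (hn : [f 0, f 1, f 2, f 3].Nodup) (p : ℕ) (hp : p < 3) :
    cdSwap p [f 0, f 1, f 2, f 3] ≠ [f 0, f 1, f 2, f 3] := by
  simp only [List.nodup_cons, List.mem_cons, List.not_mem_nil, or_false, not_or] at hn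
  interval_cases p <;> simp only [cdSwap] <;> intro h <;> simp_all

end Lists

section Cyclic

variable {v : ℕ} [NeZero v]

/-- The points of a base block in `Fin v`. -/
def cdPt (v : ℕ) [NeZero v] (e : CDEntry) (k : ℕ) : Fin v := Fin.ofNat v (e.pt k)

/-- A translate of a base block. -/
def cdBlock (e : CDEntry) (t : Fin v) : List (Fin v) :=
  [cdPt v e 0 + t, cdPt v e 1 + t, cdPt v e 2 + t, cdPt v e 3 + t]

/-- All blocks, indexed by base block and translation. -/
def cdBlk (L : List CDEntry) (x : Fin L.length × Fin v) : List (Fin v) := cdBlock L[x.1] x.2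

theorem cdPt_val (e : CDEntry) (h : cdGood v e) (k : ℕ) : (cdPt v e k : ℕ) = e.pt k := by
  obtain ⟨⟨h1, h2, h3, h4⟩, -⟩ := h
  simp only [cdPt, Fin.val_ofNat]
  apply Nat.mod_eq_of_lt
  unfold CDEntry.pt
  split <;> assumption

theorem cdPt_sub_val (e : CDEntry) (h : cdGood v e) (k l : ℕ) :
    ((cdPt v e k - cdPt v e l : Fin v) : ℕ) = cdSub v (e.pt k) (e.pt l) := by
  rw [Fin.val_sub, cdPt_val e h, cdPt_val e h, cdSub]

theorem cdPt_inj (e : CDEntry) (h : cdGood v e) {k l : ℕ} (hk : k < 4) (hl : l < 4)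
    (hkl : cdPt v e k = cdPt v e l) : k = l := by
  have h1 := congrArg Fin.val hkl
  rw [cdPt_val e h, cdPt_val e h] at h1
  obtain ⟨-, h2⟩ := h
  interval_cases k <;> interval_cases l <;> simp [CDEntry.pt] at h1 ⊢ <;> omega

theorem cdBlock_nodup (e : CDEntry) (h : cdGood v e) (t : Fin v) : (cdBlock e t).Nodup := by
  have key : ∀ k l : ℕ, k < 4 → l < 4 → k ≠ l → cdPt v e k + t ≠ cdPt v e l + t :=
    fun k l hk hl hkl h2 => hkl (cdPt_inj e h hk hl (add_right_cancel h2))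
  simp only [cdBlock, List.nodup_cons, List.mem_cons, List.not_mem_nil, or_false, not_or,
    not_false_eq_true, List.nodup_nil, and_true]
  refine ⟨⟨?_, ?_, ?_⟩, ⟨?_, ?_⟩, ?_⟩ <;> apply key <;> norm_num

theorem cdBlock_mem (e : CDEntry) (t x : Fin v) (h : x ∈ cdBlock e t) :
    ∃ k < 4, x = cdPt v e k + t := by
  simp only [cdBlock, List.mem_cons, List.not_mem_nil, or_false] at h
  rcases h with h | h | h | h
  exacts [⟨0, by norm_num, h⟩, ⟨1, by norm_num, h⟩, ⟨2, by norm_num, h⟩, ⟨3, by norm_num, h⟩]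

theorem cd_sum_shift (a b x y : Fin v) :
    (∑ t : Fin v, if a + t = x ∧ b + t = y then 1 else 0 : ℕ) =
      if b - a = y - x then 1 else 0 := by
  have h : ∀ t : Fin v, (a + t = x ∧ b + t = y) ↔ (x - a = t ∧ b - a = y - x) := by
    intro t
    constructor
    · rintro ⟨rfl, rfl⟩
      constructor <;> abel
    · rintro ⟨rfl, h2⟩
      refine ⟨by abel, ?_⟩
      have : b + (x - a) = (b - a) + x := by abel
      rw [this, h2]; abel
  simp only [h, ite_and, Finset.sum_ite_eq, Finset.mem_univ, if_true]

theorem cd_sum_block (e : CDEntry) (h : cdGood v e) (x y : Fin v) :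
    (∑ t : Fin v, if [x, y].Sublist (cdBlock e t) then 1 else 0 : ℕ) =
      cdCount v e ((y - x : Fin v) : ℕ) := by
  have h1 : ∀ t : Fin v, _ := fun t => cd_ind x y _ _ _ _ (cdBlock_nodup e h t)
  unfold cdBlock
  simp only [h1, Finset.sum_add_distrib, cd_sum_shift]
  simp only [Fin.ext_iff (b := y - x), cdPt_sub_val e h]
  rfl

/-- The unpacked properties of a good family of base blocks. -/
structure CDProps (v : ℕ) [NeZero v] (L : List CDEntry) : Prop where
  good : ∀ e ∈ L, cdGood v e
  cov : ∀ d : Fin v, d ≠ 0 → ∑ i : Fin L.length, cdCount v L[i] d = 2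
  tri : ∀ i j : Fin L.length, ∀ s ∈ cdTriples, ∀ t ∈ cdTriples,
    cdPt v L[i] s.2.1 - cdPt v L[i] s.1 = cdPt v L[j] t.2.1 - cdPt v L[j] t.1 →
    cdPt v L[i] s.2.2 - cdPt v L[i] s.1 = cdPt v L[j] t.2.2 - cdPt v L[j] t.1 → i = j ∧ s = t
  partner : ∀ e ∈ L, cdPartner v L e
  inj : ∀ i i' : Fin L.length, L[i].j = L[i'].j → i = i'

theorem cdProps_of_check (L : List CDEntry) (h : cdCheck v L = true) : CDProps v L := by
  simp only [cdCheck, Bool.and_eq_true, List.all_eq_true, decide_eq_true_eq, Bool.or_eq_true,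
    List.mem_range] at h
  obtain ⟨⟨⟨⟨⟨h0, h1⟩, h2⟩, h3⟩, h4⟩, h5⟩ := h
  have h3' := (cdFresh_nodup _ _ h3).1
  have h5' := (cdFresh_nodup _ _ h5).1
  refine ⟨h1, ?_, ?_, h4, ?_⟩
  · intro d hd
    have := (h2 d d.2).resolve_left (fun h => hd (Fin.ext (by simpa using h)))
    rw [← this]
    exact Fin.sum_univ_fun_getElem L (fun e => cdCount v e d)
  · intro i j s hs t ht e1 e2
    have gi := h1 L[i] (List.getElem_mem _)
    have gj := h1 L[j] (List.getElem_mem _)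
    have e1' := congrArg Fin.val e1
    have e2' := congrArg Fin.val e2
    rw [cdPt_sub_val _ gi, cdPt_sub_val _ gj] at e1' e2'
    have hc : cdCode v L[i] s = cdCode v L[j] t := by
      unfold cdCode; rw [e1', e2']
    rw [List.nodup_flatMap] at h3'
    obtain ⟨n1, n2⟩ := h3'
    have hij : i = j := by
      by_contra hne
      rw [List.pairwise_iff_get] at n2
      rcases lt_or_gt_of_ne hne with hlt | hlt
      · exact n2 i j hlt (List.mem_map_of_mem hs) (by
          have := List.mem_map_of_mem (f := cdCode v L[j]) ht
          rw [← hc] at this; exact this)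
      · exact n2 j i hlt (List.mem_map_of_mem ht) (by
          have := List.mem_map_of_mem (f := cdCode v L[i]) hs
          rw [hc] at this; exact this)
    subst hij
    exact ⟨rfl, List.inj_on_of_nodup_map (n1 L[i] (List.getElem_mem _)) hs ht hc⟩
  · intro i i' hi
    have := List.nodup_iff_injective_get.1 h5'
    have h6 := @this ⟨i, by simp⟩ ⟨i', by simp⟩ (by simpa using hi)
    simpa [Fin.ext_iff] using h6

theorem cdTriples_mem (a b c : ℕ) (ha : a < 4) (hb : b < 4) (hc : c < 4) (hab : a ≠ b)
    (hac : a ≠ c) (hbc : b ≠ c) : (a, b, c) ∈ cdTriples := by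
  interval_cases a <;> interval_cases b <;> interval_cases c <;> simp_all [cdTriples]

/-- Two blocks with three common points are the same. -/
theorem cd_eq_of_inter {L : List CDEntry} (H : CDProps v L) (x y : Fin L.length × Fin v)
    (h : 2 < ((cdBlk L x).toFinset ∩ (cdBlk L y).toFinset).card) : x = y := by
  obtain ⟨a, b, c, ha, hb, hc, hab, hac, hbc⟩ := Finset.two_lt_card_iff.1 h
  obtain ⟨i, s⟩ := x
  obtain ⟨j, t⟩ := y
  simp only [Finset.mem_inter, List.mem_toFinset, cdBlk] at ha hb hc
  obtain ⟨p1, lp1, hp1⟩ := cdBlock_mem _ _ _ ha.1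
  obtain ⟨q1, lq1, hq1⟩ := cdBlock_mem _ _ _ ha.2
  obtain ⟨p2, lp2, hp2⟩ := cdBlock_mem _ _ _ hb.1
  obtain ⟨q2, lq2, hq2⟩ := cdBlock_mem _ _ _ hb.2
  obtain ⟨p3, lp3, hp3⟩ := cdBlock_mem _ _ _ hc.1
  obtain ⟨q3, lq3, hq3⟩ := cdBlock_mem _ _ _ hc.2
  have sub : ∀ u w z : Fin v, u - w = (u + z) - (w + z) := fun u w z => by abel
  have key := H.tri i j (p1, p2, p3)
    (cdTriples_mem _ _ _ lp1 lp2 lp3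
      (fun e => hab (by rw [hp1, hp2, e])) (fun e => hac (by rw [hp1, hp3, e]))
      (fun e => hbc (by rw [hp2, hp3, e])))
    (q1, q2, q3)
    (cdTriples_mem _ _ _ lq1 lq2 lq3
      (fun e => hab (by rw [hq1, hq2, e])) (fun e => hac (by rw [hq1, hq3, e]))
      (fun e => hbc (by rw [hq2, hq3, e])))
    (by
      have e := sub (cdPt v L[i] p2) (cdPt v L[i] p1) s
      rw [← hp1, ← hp2, hq1, hq2] at e
      exact e.trans (sub _ _ t).symm)
    (by
      have e := sub (cdPt v L[i] p3) (cdPt v L[i] p1) s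
      rw [← hp1, ← hp3, hq1, hq3] at e
      exact e.trans (sub _ _ t).symm)
  obtain ⟨rfl, k2⟩ := key
  have k3 : p1 = q1 := congrArg Prod.fst k2
  subst k3
  rw [hp1] at hq1
  rw [add_left_cancel hq1]

theorem cdBlk_nodup {L : List CDEntry} (H : CDProps v L) (x : Fin L.length × Fin v) :
    (cdBlk L x).Nodup := cdBlock_nodup _ (H.good _ (List.getElem_mem _)) _

theorem cd_eq_of_perm {L : List CDEntry} (H : CDProps v L) (x y : Fin L.length × Fin v)
    (h : (cdBlk L x).Perm (cdBlk L y)) : x = y := by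
  apply cd_eq_of_inter H
  rw [List.toFinset_eq_of_perm _ _ h, Finset.inter_self,
    List.toFinset_card_of_nodup (cdBlk_nodup H y)]
  simp [cdBlk, cdBlock]

theorem cdBlk_injective {L : List CDEntry} (H : CDProps v L) :
    Function.Injective (cdBlk (v := v) L) :=
  fun x y h => cd_eq_of_perm H x y (by rw [h])

/-- The cyclic directed design. -/
def cdDesign (L : List CDEntry) (H : CDProps v L) : DirectedDesign (Fin v) 2 4 2 where
  blocks := (Finset.univ : Finset (Fin L.length × Fin v)).val.map (cdBlk L)
  len := by
    intro b hb
    obtain ⟨x, -, rfl⟩ := Multiset.mem_map.1 hb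
    rfl
  nodup := by
    intro b hb
    obtain ⟨x, -, rfl⟩ := Multiset.mem_map.1 hb
    exact cdBlk_nodup H x
  covers := by
    intro s hs hn
    obtain ⟨x, y, rfl⟩ := List.length_eq_two.1 hs
    have hxy : y - x ≠ 0 := by
      intro h
      simp [sub_eq_zero.1 h] at hn
    rw [Multiset.countP_map, ← Finset.filter_val, Finset.card_val, Finset.card_filter,
      Fintype.sum_prod_type, ← H.cov _ hxy]
    exact Finset.sum_congr rfl
      (fun i _ => cd_sum_block L[i] (H.good _ (List.getElem_mem _)) x y)

theorem cdDesign_nodup (L : List CDEntry) (H : CDProps v L) : (cdDesign L H).blocks.Nodup :=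
  Finset.univ.nodup.map (cdBlk_injective H)

theorem cdDesign_mem (L : List CDEntry) (H : CDProps v L) (x : Fin L.length × Fin v) :
    cdBlk L x ∈ (cdDesign L H).blocks :=
  Multiset.mem_map_of_mem _ (Finset.mem_univ x)

theorem cdDesign_superSimple (L : List CDEntry) (H : CDProps v L) :
    (cdDesign L H).SuperSimple := by
  refine ⟨cdDesign_nodup L H, ?_⟩
  intro b₁ h₁ b₂ h₂ hne
  obtain ⟨x, -, rfl⟩ := Multiset.mem_map.1 h₁
  obtain ⟨y, -, rfl⟩ := Multiset.mem_map.1 h₂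
  by_contra hlt
  exact hne (by rw [cd_eq_of_inter H x y (not_le.1 hlt)])

/-- The trade partner map on blocks. -/
def cdNext (L : List CDEntry) (H : CDProps v L) (x : Fin L.length × Fin v) :
    Fin L.length × Fin v :=
  let e := L[x.1]
  have h : e.j < L.length := (H.partner e (List.getElem_mem _)).2.2.1
  (⟨e.j, h⟩, cdPt v e e.p - cdPt v L[e.j] (e.q + 1) + x.2)

theorem cdNext_injective (L : List CDEntry) (H : CDProps v L) :
    Function.Injective (cdNext L H) := by
  rintro ⟨i, s⟩ ⟨j, t⟩ h
  simp only [cdNext, Prod.mk.injEq, Fin.mk.injEq] at h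
  have := H.inj i j h.1
  subst this
  simpa using h.2

/-- A defining set meets every pair of trade partners. -/
theorem cd_meets (L : List CDEntry) (H : CDProps v L) (S : Multiset (List (Fin v)))
    (hS : (cdDesign L H).IsDefiningSet S) (x : Fin L.length × Fin v) :
    cdBlk L x ∈ S ∨ cdBlk L (cdNext L H x) ∈ S := by
  by_contra hcon
  rw [not_or] at hcon
  obtain ⟨n1, n2⟩ := hcon
  obtain ⟨i, t⟩ := x
  set y := cdNext L H (i, t) with hy
  obtain ⟨hp, hq, hj, hd⟩ := H.partner L[i] (List.getElem_mem _)
  set p := L[i].p with hpdef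
  set q := L[i].q with hqdef
  let f : ℕ → Fin v := fun k => cdPt v L[i] k + t
  let g : ℕ → Fin v := fun k => cdPt v L[y.1] k + y.2
  have hf : cdBlk L (i, t) = [f 0, f 1, f 2, f 3] := rfl
  have hg : cdBlk L y = [g 0, g 1, g 2, g 3] := rfl
  have fn := cdBlk_nodup H (i, t)
  have gn := cdBlk_nodup H y
  have e1 : g (q + 1) = f p := by
    change cdPt v L[L[i].j] (q + 1) + (cdPt v L[i] p - cdPt v L[L[i].j] (q + 1) + t) =
      cdPt v L[i] p + t
    abel
  have hd' : cdPt v L[i] (p + 1) - cdPt v L[i] p =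
      cdPt v L[L[i].j] q - cdPt v L[L[i].j] (q + 1) := by
    apply Fin.ext
    have m1 : cdGood v L[i] := H.good _ (List.getElem_mem _)
    have m2 : cdGood v L[L[i].j] := H.good _ (List.getElem_mem _)
    rw [cdPt_sub_val _ m1, cdPt_sub_val _ m2]
    exact hd
  have e2 : g q = f (p + 1) := by
    change cdPt v L[L[i].j] q + (cdPt v L[i] p - cdPt v L[L[i].j] (q + 1) + t) =
      cdPt v L[i] (p + 1) + t
    have : cdPt v L[L[i].j] q + (cdPt v L[i] p - cdPt v L[L[i].j] (q + 1) + t) =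
      (cdPt v L[L[i].j] q - cdPt v L[L[i].j] (q + 1)) + cdPt v L[i] p + t := by abel
    rw [this, ← hd']; abel
  rw [hf] at fn n1
  rw [hg] at gn n2
  have hfm : [f 0, f 1, f 2, f 3] ∈ (cdDesign L H).blocks := cdDesign_mem L H (i, t)
  have hgm : [g 0, g 1, g 2, g 3] ∈ (cdDesign L H).blocks := cdDesign_mem L H y
  have balance : ∀ a b : Fin v,
      (if [a, b].Sublist (cdSwap p [f 0, f 1, f 2, f 3]) then 1 else 0 : ℕ) +
        (if [a, b].Sublist (cdSwap q [g 0, g 1, g 2, g 3]) then 1 else 0) =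
      (if [a, b].Sublist [f 0, f 1, f 2, f 3] then 1 else 0) +
        (if [a, b].Sublist [g 0, g 1, g 2, g 3] then 1 else 0) := by
    intro a b
    have s1 := cdSwap_ind f fn p hp a b
    have s2 := cdSwap_ind g gn q hq a b
    rw [e1, e2] at s2
    omega
  have hfg : [f 0, f 1, f 2, f 3] ≠ [g 0, g 1, g 2, g 3] := by
    intro h
    -- the pair occurs in opposite orders
    have inj : ∀ k l, k < 4 → l < 4 → f k = f l → k = l := fun k l hk hl h =>
      cdPt_inj _ (H.good _ (List.getElem_mem _)) hk hl (add_right_cancel h)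
    simp only [List.cons.injEq, and_true] at h
    obtain ⟨k0, k1, k2, k3⟩ := h
    have hk : ∀ k < 4, g k = f k := by
      intro k hk
      interval_cases k
      exacts [k0.symm, k1.symm, k2.symm, k3.symm]
    rw [hk _ (by omega)] at e1 e2
    have := inj _ _ (by omega) (by omega) e1
    have := inj _ _ (by omega) (by omega) e2
    omega
  obtain ⟨R₁, hR₁⟩ := Multiset.exists_cons_of_mem hfm
  have hgm' : [g 0, g 1, g 2, g 3] ∈ R₁ := by
    rw [hR₁, Multiset.mem_cons] at hgm
    exact hgm.resolve_left (Ne.symm hfg)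
  obtain ⟨R, rfl⟩ := Multiset.exists_cons_of_mem hgm'
  have hSR : S ≤ R := by
    have := hS.1
    rw [hR₁, Multiset.le_cons_of_notMem n1, Multiset.le_cons_of_notMem n2] at this
    exact this
  have hRm : ∀ b ∈ R, b ∈ (cdDesign L H).blocks := by
    intro b hb
    rw [hR₁]
    exact Multiset.mem_cons_of_mem (Multiset.mem_cons_of_mem hb)
  let D' : DirectedDesign (Fin v) 2 4 2 :=
    { blocks := cdSwap p [f 0, f 1, f 2, f 3] ::ₘ cdSwap q [g 0, g 1, g 2, g 3] ::ₘ R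
      len := by
        intro b hb
        rcases Multiset.mem_cons.1 hb with rfl | hb
        · exact (cdSwap_perm _ _).length_eq
        rcases Multiset.mem_cons.1 hb with rfl | hb
        · exact (cdSwap_perm _ _).length_eq
        exact (cdDesign L H).len b (hRm b hb)
      nodup := by
        intro b hb
        rcases Multiset.mem_cons.1 hb with rfl | hb
        · exact (cdSwap_perm _ _).nodup_iff.2 fn
        rcases Multiset.mem_cons.1 hb with rfl | hb
        · exact (cdSwap_perm _ _).nodup_iff.2 gn
        exact (cdDesign L H).nodup b (hRm b hb)
      covers := by
        intro s hs hn
        have hc := (cdDesign L H).covers s hs hn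
        rw [hR₁, Multiset.countP_cons, Multiset.countP_cons] at hc
        rw [Multiset.countP_cons, Multiset.countP_cons]
        obtain ⟨a, b, rfl⟩ := List.length_eq_two.1 hs
        have := balance a b
        omega }
  have hD' := hS.2 D' (hSR.trans ((Multiset.le_cons_self _ _).trans (Multiset.le_cons_self _ _)))
  have hmem : cdSwap p [f 0, f 1, f 2, f 3] ∈ (cdDesign L H).blocks := by
    rw [← hD']
    exact Multiset.mem_cons_self _ _
  obtain ⟨z, -, hz⟩ := Multiset.mem_map.1 hmem
  have hzx : z = (i, t) := by
    apply cd_eq_of_perm H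
    rw [hz, hf]
    exact cdSwap_perm _ _
  rw [hzx, hf] at hz
  exact cdSwap_ne f fn p hp hz.symm

theorem cdDesign_half (L : List CDEntry) (H : CDProps v L) : (cdDesign L H).DefiningHalf := by
  intro S hS
  have hcard : Multiset.card (cdDesign L H).blocks =
      (Finset.univ : Finset (Fin L.length × Fin v)).card := by
    simp only [cdDesign, Multiset.card_map]
    rfl
  let A : Finset (Fin L.length × Fin v) := Finset.univ.filter (fun x => cdBlk L x ∈ S)
  let A' : Finset (Fin L.length × Fin v) :=
    Finset.univ.filter (fun x => cdBlk L (cdNext L H x) ∈ S)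
  have hu : (Finset.univ : Finset (Fin L.length × Fin v)) ⊆ A ∪ A' := by
    intro x _
    have := cd_meets L H S hS x
    simpa [A, A'] using this
  have hA : A.card ≤ S.toFinset.card :=
    Finset.card_le_card_of_injOn (cdBlk L) (fun x hx => by simpa [A] using hx)
      (cdBlk_injective H).injOn
  have hA' : A'.card ≤ S.toFinset.card :=
    Finset.card_le_card_of_injOn (fun x => cdBlk L (cdNext L H x))
      (fun x hx => by simpa [A'] using hx)
      ((cdBlk_injective H).comp (cdNext_injective L H)).injOn
  have h1 := Finset.card_le_card hu
  have h2 := Finset.card_union_le A A'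
  have h3 := Multiset.toFinset_card_le S
  omega

end Cyclic

/-- A family of base blocks passing the test yields the required design. -/
theorem cd_main (v : ℕ) (L : List CDEntry) (h : cdCheck v L = true) :
    ∃ D : DirectedDesign (Fin v) 2 4 2, D.SuperSimple ∧ D.DefiningHalf := by
  have hv : 0 < v := by
    simp only [cdCheck, Bool.and_eq_true, decide_eq_true_eq] at h
    exact h.1.1.1.1.1
  have : NeZero v := ⟨hv.ne'⟩
  have H := cdProps_of_check L h
  exact ⟨cdDesign L H, cdDesign_superSimple L H, cdDesign_half L H⟩

/-- Base blocks over `ℤ/10` with the trade partner of each. -/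
def cdBase10 : List CDEntry :=
  [⟨8, 2, 4, 3, 1, 0, 1⟩, ⟨5, 2, 8, 0, 2, 1, 0⟩, ⟨6, 0, 9, 7, 0, 2, 1⟩]

theorem cdBase10_ok : cdCheck 10 cdBase10 = true := by decide +kernel

/-- Base blocks over `ℤ/13` with the trade partner of each. -/
def cdBase13 : List CDEntry :=
  [⟨7, 6, 4, 10, 3, 2, 0⟩, ⟨6, 8, 0, 1, 2, 2, 0⟩, ⟨5, 4, 1, 6, 1, 0, 2⟩,
   ⟨9, 3, 12, 7, 0, 0, 2⟩]

theorem cdBase13_ok : cdCheck 13 cdBase13 = true := by decide +kernel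

/-- Base blocks over `ℤ/16` with the trade partner of each. -/
def cdBase16 : List CDEntry :=
  [⟨8, 15, 9, 7, 1, 1, 2⟩, ⟨11, 2, 14, 4, 3, 1, 2⟩, ⟨3, 1, 14, 0, 2, 0, 2⟩,
   ⟨13, 2, 3, 7, 4, 0, 1⟩, ⟨3, 11, 6, 15, 0, 2, 0⟩]

theorem cdBase16_ok : cdCheck 16 cdBase16 = true := by decide +kernel

/-- Base blocks over `ℤ/19` with the trade partner of each. -/
def cdBase19 : List CDEntry :=
  [⟨13, 12, 3, 0, 5, 0, 1⟩, ⟨2, 5, 0, 11, 3, 2, 0⟩, ⟨7, 9, 1, 8, 4, 1, 2⟩,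
   ⟨7, 15, 0, 12, 2, 0, 1⟩, ⟨12, 3, 8, 16, 1, 1, 1⟩, ⟨5, 0, 1, 3, 0, 1, 0⟩]

theorem cdBase19_ok : cdCheck 19 cdBase19 = true := by decide +kernel

/-- Base blocks over `ℤ/22` with the trade partner of each. -/
def cdBase22 : List CDEntry :=
  [⟨0, 18, 20, 11, 6, 0, 0⟩, ⟨20, 1, 7, 15, 2, 0, 2⟩, ⟨8, 2, 7, 4, 1, 0, 1⟩,
   ⟨3, 16, 15, 0, 5, 1, 2⟩, ⟨17, 3, 15, 4, 4, 2, 2⟩, ⟨10, 20, 14, 15, 3, 2, 1⟩,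
   ⟨12, 16, 4, 19, 0, 0, 0⟩]

theorem cdBase22_ok : cdCheck 22 cdBase22 = true := by decide +kernel

/-- Base blocks over `ℤ/25` with the trade partner of each. -/
def cdBase25 : List CDEntry :=
  [⟨22, 7, 16, 19, 6, 0, 0⟩, ⟨20, 5, 6, 2, 5, 0, 0⟩, ⟨21, 23, 0, 3, 7, 0, 1⟩,
   ⟨10, 14, 19, 5, 4, 1, 1⟩, ⟨5, 22, 17, 23, 3, 1, 1⟩, ⟨22, 12, 5, 18, 1, 0, 0⟩,
   ⟨0, 15, 14, 13, 0, 0, 0⟩, ⟨4, 20, 18, 12, 2, 1, 0⟩]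

theorem cdBase25_ok : cdCheck 25 cdBase25 = true := by decide +kernel

/-- Base blocks over `ℤ/28` with the trade partner of each. -/
def cdBase28 : List CDEntry :=
  [⟨17, 25, 8, 9, 7, 1, 1⟩, ⟨13, 3, 20, 6, 1, 2, 2⟩, ⟨14, 19, 24, 2, 8, 0, 2⟩,
   ⟨6, 10, 0, 8, 6, 2, 1⟩, ⟨1, 10, 23, 20, 5, 1, 2⟩, ⟨10, 8, 7, 22, 4, 2, 1⟩,
   ⟨10, 14, 6, 9, 3, 1, 2⟩, ⟨7, 14, 3, 16, 0, 1, 1⟩, ⟨19, 6, 12, 7, 2, 2, 0⟩]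

theorem cdBase28_ok : cdCheck 28 cdBase28 = true := by decide +kernel

/-- Base blocks over `ℤ/31` with the trade partner of each. -/
def cdBase31 : List CDEntry :=
  [⟨17, 12, 0, 7, 6, 2, 2⟩, ⟨1, 19, 11, 30, 9, 2, 0⟩, ⟨3, 23, 9, 8, 7, 1, 2⟩,
   ⟨22, 4, 19, 13, 1, 0, 0⟩, ⟨25, 24, 17, 26, 8, 1, 0⟩, ⟨16, 1, 12, 3, 3, 0, 1⟩,
   ⟨27, 24, 8, 1, 5, 1, 0⟩, ⟨30, 3, 24, 7, 2, 2, 1⟩, ⟨26, 2, 29, 8, 4, 0, 1⟩,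
   ⟨6, 18, 4, 7, 0, 0, 1⟩]

theorem cdBase31_ok : cdCheck 31 cdBase31 = true := by decide +kernel

/-- Base blocks over `ℤ/34` with the trade partner of each. -/
def cdBase34 : List CDEntry :=
  [⟨29, 28, 7, 17, 7, 0, 2⟩, ⟨25, 21, 31, 26, 3, 0, 1⟩, ⟨1, 19, 30, 27, 4, 2, 1⟩,
   ⟨2, 0, 4, 20, 2, 2, 0⟩, ⟨15, 19, 22, 2, 6, 1, 1⟩, ⟨25, 10, 23, 13, 9, 0, 1⟩,
   ⟨6, 15, 12, 23, 8, 2, 1⟩, ⟨33, 8, 23, 24, 10, 2, 1⟩, ⟨23, 25, 14, 19, 1, 2, 2⟩,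
   ⟨10, 2, 17, 29, 5, 1, 0⟩, ⟨25, 12, 11, 5, 0, 0, 1⟩]

theorem cdBase34_ok : cdCheck 34 cdBase34 = true := by decide +kernel

/-- Base blocks over `ℤ/40` with the trade partner of each. -/
def cdBase40 : List CDEntry :=
  [⟨3, 26, 30, 5, 10, 0, 1⟩, ⟨8, 11, 17, 19, 3, 1, 2⟩, ⟨38, 24, 39, 30, 7, 1, 0⟩,
   ⟨23, 14, 27, 21, 1, 2, 1⟩, ⟨7, 33, 26, 31, 11, 2, 2⟩, ⟨27, 36, 24, 17, 8, 1, 1⟩,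
   ⟨2, 20, 36, 16, 9, 0, 0⟩, ⟨20, 5, 34, 4, 2, 0, 1⟩, ⟨18, 23, 35, 13, 12, 2, 2⟩,
   ⟨22, 4, 33, 5, 5, 2, 1⟩, ⟨14, 34, 11, 10, 6, 0, 2⟩, ⟨28, 9, 1, 36, 4, 2, 2⟩,
   ⟨39, 2, 27, 9, 0, 1, 2⟩]

theorem cdBase40_ok : cdCheck 40 cdBase40 = true := by decide +kernel

/-- Base blocks over `ℤ/43` with the trade partner of each. -/
def cdBase43 : List CDEntry :=
  [⟨18, 5, 30, 25, 4, 1, 1⟩, ⟨36, 12, 4, 19, 9, 2, 2⟩, ⟨11, 0, 17, 14, 11, 1, 2⟩,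
   ⟨19, 5, 21, 41, 12, 2, 0⟩, ⟨22, 38, 13, 10, 0, 1, 1⟩, ⟨14, 23, 24, 35, 10, 0, 0⟩,
   ⟨29, 39, 10, 34, 7, 0, 0⟩, ⟨29, 19, 13, 11, 6, 0, 0⟩, ⟨2, 41, 29, 34, 13, 0, 2⟩,
   ⟨9, 27, 3, 31, 1, 2, 2⟩, ⟨29, 20, 37, 7, 5, 0, 0⟩, ⟨39, 29, 9, 35, 2, 2, 1⟩,
   ⟨21, 1, 30, 29, 3, 0, 2⟩, ⟨39, 40, 38, 42, 8, 2, 0⟩]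

theorem cdBase43_ok : cdCheck 43 cdBase43 = true := by decide +kernel

/-- Base blocks over `ℤ/58` with the trade partner of each. -/
def cdBase58 : List CDEntry :=
  [⟨53, 39, 42, 2, 8, 1, 0⟩, ⟨35, 54, 21, 9, 13, 2, 1⟩, ⟨4, 40, 38, 49, 9, 0, 1⟩,
   ⟨47, 40, 20, 4, 15, 1, 1⟩, ⟨51, 48, 54, 30, 6, 1, 1⟩, ⟨26, 34, 32, 7, 14, 0, 1⟩,
   ⟨38, 29, 23, 46, 4, 1, 1⟩, ⟨42, 43, 47, 30, 10, 1, 0⟩, ⟨44, 41, 9, 3, 0, 0, 1⟩,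
   ⟨12, 25, 47, 54, 2, 1, 0⟩, ⟨11, 7, 3, 21, 7, 0, 1⟩, ⟨2, 37, 32, 6, 17, 2, 2⟩,
   ⟨41, 52, 53, 10, 16, 2, 0⟩, ⟨41, 31, 43, 22, 1, 1, 2⟩, ⟨50, 30, 22, 32, 5, 1, 0⟩,
   ⟨3, 8, 28, 44, 3, 1, 1⟩, ⟨32, 17, 41, 31, 12, 0, 2⟩, ⟨11, 39, 32, 0, 11, 2, 2⟩,
   ⟨50, 21, 16, 49, 18, 0, 0⟩]

theorem cdBase58_ok : cdCheck 58 cdBase58 = true := by decide +kernel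

/-- Base blocks over `ℤ/67` with the trade partner of each. -/
def cdBase67 : List CDEntry :=
  [⟨39, 23, 28, 5, 12, 2, 1⟩, ⟨43, 15, 11, 13, 18, 0, 2⟩, ⟨60, 2, 8, 34, 20, 1, 1⟩,
   ⟨16, 56, 7, 37, 4, 1, 1⟩, ⟨51, 50, 32, 18, 3, 1, 1⟩, ⟨46, 49, 2, 24, 17, 1, 0⟩,
   ⟨37, 66, 51, 61, 19, 2, 2⟩, ⟨28, 6, 66, 35, 15, 2, 1⟩, ⟨55, 7, 40, 47, 11, 1, 2⟩,
   ⟨30, 55, 34, 10, 10, 2, 1⟩, ⟨21, 14, 38, 26, 9, 1, 2⟩, ⟨6, 60, 57, 24, 8, 2, 1⟩,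
   ⟨19, 6, 29, 56, 0, 1, 2⟩, ⟨59, 20, 31, 8, 16, 1, 1⟩, ⟨56, 57, 54, 48, 21, 1, 1⟩,
   ⟨38, 24, 55, 51, 7, 1, 2⟩, ⟨16, 29, 18, 24, 13, 1, 1⟩, ⟨29, 9, 50, 59, 5, 0, 1⟩,
   ⟨20, 19, 34, 62, 1, 2, 0⟩, ⟨49, 2, 28, 18, 6, 2, 2⟩, ⟨27, 65, 59, 17, 2, 1, 1⟩,
   ⟨6, 14, 17, 18, 14, 1, 1⟩]

theorem cdBase67_ok : cdCheck 67 cdBase67 = true := by decide +kernel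

/-- Base blocks over `ℤ/79` with the trade partner of each. -/
def cdBase79 : List CDEntry :=
  [⟨11, 21, 35, 6, 6, 0, 1⟩, ⟨32, 4, 50, 57, 15, 1, 0⟩, ⟨42, 57, 46, 19, 16, 1, 2⟩,
   ⟨33, 11, 61, 13, 19, 0, 2⟩, ⟨51, 62, 66, 16, 7, 1, 1⟩, ⟨15, 11, 45, 43, 8, 1, 1⟩,
   ⟨64, 40, 30, 53, 13, 0, 0⟩, ⟨60, 22, 18, 1, 4, 1, 1⟩, ⟨3, 56, 22, 19, 24, 2, 0⟩,
   ⟨74, 0, 64, 65, 20, 2, 1⟩, ⟨30, 0, 51, 39, 18, 2, 0⟩, ⟨2, 64, 50, 57, 12, 0, 0⟩,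
   ⟨4, 21, 50, 3, 0, 1, 2⟩, ⟨66, 11, 67, 36, 3, 2, 2⟩, ⟨12, 47, 22, 20, 22, 0, 2⟩,
   ⟨21, 54, 68, 60, 11, 1, 1⟩, ⟨61, 69, 53, 64, 2, 2, 1⟩, ⟨14, 57, 74, 8, 25, 0, 1⟩,
   ⟨74, 7, 42, 1, 10, 0, 2⟩, ⟨42, 44, 1, 23, 5, 0, 2⟩, ⟨2, 23, 22, 65, 9, 1, 2⟩,
   ⟨71, 14, 51, 26, 23, 0, 1⟩, ⟨42, 47, 29, 73, 14, 2, 0⟩, ⟨27, 36, 14, 54, 21, 1, 0⟩,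
   ⟨59, 62, 6, 78, 1, 2, 2⟩, ⟨62, 53, 10, 50, 17, 1, 0⟩]

theorem cdBase79_ok : cdCheck 79 cdBase79 = true := by decide +kernel

/-- Base blocks over `ℤ/94` with the trade partner of each. -/
def cdBase94 : List CDEntry :=
  [⟨83, 58, 60, 66, 21, 1, 2⟩, ⟨76, 57, 63, 83, 14, 2, 2⟩, ⟨45, 58, 79, 19, 22, 2, 0⟩,
   ⟨79, 60, 20, 5, 19, 2, 0⟩, ⟨64, 24, 89, 81, 16, 0, 1⟩, ⟨26, 92, 28, 89, 11, 2, 2⟩,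
   ⟨20, 21, 44, 58, 10, 2, 2⟩, ⟨48, 42, 84, 75, 27, 1, 1⟩, ⟨39, 7, 50, 91, 28, 1, 1⟩,
   ⟨73, 40, 63, 28, 25, 2, 2⟩, ⟨43, 30, 89, 75, 6, 2, 2⟩, ⟨40, 24, 80, 19, 5, 2, 2⟩,
   ⟨23, 17, 1, 38, 24, 1, 1⟩, ⟨83, 53, 42, 52, 15, 1, 1⟩, ⟨61, 79, 58, 38, 1, 2, 2⟩,
   ⟨66, 41, 52, 70, 13, 1, 1⟩, ⟨12, 3, 43, 41, 4, 1, 0⟩, ⟨20, 0, 64, 77, 23, 1, 1⟩,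
   ⟨13, 41, 60, 92, 3, 1, 0⟩, ⟨41, 56, 48, 87, 29, 2, 0⟩, ⟨4, 47, 51, 29, 26, 1, 1⟩,
   ⟨23, 85, 49, 47, 0, 2, 1⟩, ⟨37, 3, 45, 73, 2, 0, 2⟩, ⟨0, 67, 3, 17, 17, 1, 1⟩,
   ⟨80, 73, 89, 92, 12, 1, 1⟩, ⟨44, 71, 18, 53, 9, 2, 2⟩, ⟨80, 79, 75, 68, 20, 1, 1⟩,
   ⟨53, 49, 7, 65, 7, 1, 1⟩, ⟨25, 90, 47, 1, 8, 1, 1⟩, ⟨7, 62, 17, 67, 30, 1, 0⟩,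
   ⟨80, 31, 81, 53, 18, 2, 0⟩]

theorem cdBase94_ok : cdCheck 94 cdBase94 = true := by decide +kernel

/-- Base blocks over `ℤ/103` with the trade partner of each. -/
def cdBase103 : List CDEntry :=
  [⟨89, 47, 40, 99, 4, 1, 1⟩, ⟨79, 41, 40, 85, 25, 1, 1⟩, ⟨47, 16, 22, 46, 29, 0, 0⟩,
   ⟨79, 93, 39, 61, 16, 2, 2⟩, ⟨61, 93, 100, 16, 0, 1, 1⟩, ⟨78, 2, 6, 40, 23, 2, 2⟩,
   ⟨23, 95, 8, 76, 31, 1, 2⟩, ⟨50, 44, 33, 68, 18, 1, 1⟩, ⟨49, 62, 19, 59, 33, 2, 0⟩,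
   ⟨35, 56, 71, 29, 12, 2, 2⟩, ⟨8, 56, 88, 10, 14, 2, 2⟩, ⟨49, 77, 2, 61, 24, 0, 2⟩,
   ⟨1, 61, 27, 69, 9, 2, 2⟩, ⟨37, 72, 80, 60, 21, 2, 2⟩, ⟨34, 84, 26, 1, 10, 2, 2⟩,
   ⟨68, 80, 20, 87, 19, 0, 1⟩, ⟨82, 52, 4, 85, 3, 2, 2⟩, ⟨34, 43, 30, 10, 20, 0, 1⟩,
   ⟨67, 65, 76, 54, 7, 1, 1⟩, ⟨22, 27, 15, 1, 15, 1, 0⟩, ⟨30, 68, 59, 12, 17, 1, 0⟩,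
   ⟨56, 69, 85, 2, 13, 2, 2⟩, ⟨93, 36, 38, 78, 28, 1, 2⟩, ⟨55, 41, 92, 58, 5, 2, 2⟩,
   ⟨0, 74, 51, 23, 11, 2, 0⟩, ⟨53, 25, 26, 92, 1, 1, 1⟩, ⟨19, 93, 69, 23, 32, 2, 0⟩,
   ⟨6, 53, 68, 27, 30, 2, 0⟩, ⟨73, 91, 54, 52, 22, 2, 1⟩, ⟨99, 27, 18, 10, 2, 0, 0⟩,
   ⟨94, 32, 28, 62, 27, 0, 2⟩, ⟨68, 58, 85, 69, 6, 2, 1⟩, ⟨54, 100, 51, 95, 26, 0, 2⟩,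
   ⟨90, 50, 40, 45, 8, 0, 2⟩]

theorem cdBase103_ok : cdCheck 103 cdBase103 = true := by decide +kernel

/-- For every `v` in the given set there exists a super-simple
`2-(v,4,2)` directed design in which every defining set contains at least
half of the blocks. -/
theorem exists_superSimple_DD_half_small (v : ℕ)
    (hv : v ∈ ({10, 13, 16, 19, 22, 25, 28, 31, 34, 40, 43, 58, 67, 79, 94, 103} : Finset ℕ)) :
    ∃ D : DirectedDesign (Fin v) 2 4 2, D.SuperSimple ∧ D.DefiningHalf := by
  simp only [Finset.mem_insert, Finset.mem_singleton] at hv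
  rcases hv with rfl | rfl | rfl | rfl | rfl | rfl | rfl | rfl | rfl | rfl | rfl | rfl | rfl | rfl | rfl | rfl
  · exact cd_main 10 cdBase10 cdBase10_ok
  · exact cd_main 13 cdBase13 cdBase13_ok
  · exact cd_main 16 cdBase16 cdBase16_ok
  · exact cd_main 19 cdBase19 cdBase19_ok
  · exact cd_main 22 cdBase22 cdBase22_ok
  · exact cd_main 25 cdBase25 cdBase25_ok
  · exact cd_main 28 cdBase28 cdBase28_ok
  · exact cd_main 31 cdBase31 cdBase31_ok
  · exact cd_main 34 cdBase34 cdBase34_ok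
  · exact cd_main 40 cdBase40 cdBase40_ok
  · exact cd_main 43 cdBase43 cdBase43_ok
  · exact cd_main 58 cdBase58 cdBase58_ok
  · exact cd_main 67 cdBase67 cdBase67_ok
  · exact cd_main 79 cdBase79 cdBase79_ok
  · exact cd_main 94 cdBase94 cdBase94_ok
  · exact cd_main 103 cdBase103 cdBase103_ok
end

section
/- For every t ∈ {6, 7, 8, 9, 13} there exists a super-simple (4,2)-DGDD of type 3^t in which every defining set contains at least half of the blocks. -/
/-- Two blocks `l₁ a b l₂` and `l₃ b a l₄`, forming a trade by swapping `a` and `b`. -/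
structure SwapPair (X : Type) where
  l₁ : List X
  a : X
  b : X
  l₂ : List X
  l₃ : List X
  l₄ : List X

namespace SwapPair

variable {X : Type}

/-- First block. -/
def B (p : SwapPair X) : List X := p.l₁ ++ p.a :: p.b :: p.l₂
/-- Second block. -/
def C (p : SwapPair X) : List X := p.l₃ ++ p.b :: p.a :: p.l₄
/-- First block after the swap. -/
def B' (p : SwapPair X) : List X := p.l₁ ++ p.b :: p.a :: p.l₂
/-- Second block after the swap. -/
def C' (p : SwapPair X) : List X := p.l₃ ++ p.a :: p.b :: p.l₄

/-- Translate. -/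
def shift [Add X] (h : X) (p : SwapPair X) : SwapPair X :=
  ⟨p.l₁.map (· + h), p.a + h, p.b + h, p.l₂.map (· + h), p.l₃.map (· + h), p.l₄.map (· + h)⟩

/-- The blocks of a list of swap pairs. -/
def blocksOf (P : List (SwapPair X)) : List (List X) := P.flatMap fun p => [p.B, p.C]

theorem shift_B [Add X] (h : X) (p : SwapPair X) : (p.shift h).B = p.B.map (· + h) := by
  simp [B, shift]

theorem shift_C [Add X] (h : X) (p : SwapPair X) : (p.shift h).C = p.C.map (· + h) := by
  simp [C, shift]

theorem perm_B (p : SwapPair X) : p.B'.Perm p.B :=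
  List.Perm.append_left _ (List.Perm.swap _ _ _)

theorem perm_C (p : SwapPair X) : p.C'.Perm p.C :=
  List.Perm.append_left _ (List.Perm.swap _ _ _)

end SwapPair

theorem pair_sublist_cons {X : Type} (x y c : X) (l : List X) :
    [x, y].Sublist (c :: l) ↔ [x, y].Sublist l ∨ (x = c ∧ y ∈ l) := by
  rw [List.sublist_cons_iff]
  constructor
  · rintro (h | ⟨r, hr, h⟩)
    · exact Or.inl h
    · simp only [List.cons.injEq] at hr
      obtain ⟨rfl, rfl⟩ := hr
      exact Or.inr ⟨rfl, List.singleton_sublist.1 h⟩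
  · rintro (h | ⟨rfl, h⟩)
    · exact Or.inl h
    · exact Or.inr ⟨[y], rfl, List.singleton_sublist.2 h⟩

theorem pair_sublist_swap {X : Type} (x y a b : X) (l₁ l₂ : List X)
    (h₁ : ¬ (x = a ∧ y = b)) (h₂ : ¬ (x = b ∧ y = a)) :
    [x, y].Sublist (l₁ ++ a :: b :: l₂) ↔ [x, y].Sublist (l₁ ++ b :: a :: l₂) := by
  induction l₁ with
  | nil =>
    simp only [List.nil_append, pair_sublist_cons, List.mem_cons]
    tauto
  | cons c l ih =>
    simp only [List.cons_append, pair_sublist_cons, ih, List.mem_append, List.mem_cons]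
    tauto

theorem pair_sublist_self {X : Type} (a b : X) (l₁ l₂ : List X) :
    [a, b].Sublist (l₁ ++ a :: b :: l₂) := by
  have : [a, b].Sublist (a :: b :: l₂) := by simp
  exact this.trans (List.sublist_append_right _ _)

theorem pair_not_sublist {X : Type} (a b : X) (l₁ l₂ : List X)
    (h : (l₁ ++ b :: a :: l₂).Nodup) :
    ¬ [a, b].Sublist (l₁ ++ b :: a :: l₂) := by
  induction l₁ with
  | nil =>
    simp only [List.nil_append, List.nodup_cons, List.mem_cons, not_or] at h
    simp only [List.nil_append, pair_sublist_cons, List.mem_cons]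
    rintro ((h' | h') | h')
    · exact h.1.2 (h'.subset (by simp))
    · exact h.1.2 h'.2
    · exact h.1.1 h'.1.symm
  | cons c l ih =>
    simp only [List.cons_append, List.nodup_cons, List.mem_append, List.mem_cons, not_or] at h
    simp only [List.cons_append, pair_sublist_cons]
    rintro (h' | h')
    · exact ih h.2 h'
    · exact h.1.2.2.1 h'.1.symm

theorem swap_balanced {X : Type} [DecidableEq X] (p : SwapPair X) (hB : p.B.Nodup)
    (hC : p.C.Nodup) (x y : X) :
    ((if [x, y].Sublist p.B then 1 else 0) + (if [x, y].Sublist p.C then 1 else 0) : ℕ) =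
    (if [x, y].Sublist p.B' then 1 else 0) + (if [x, y].Sublist p.C' then 1 else 0) := by
  have hB' : p.B'.Nodup := p.perm_B.nodup_iff.2 hB
  have hC' : p.C'.Nodup := p.perm_C.nodup_iff.2 hC
  by_cases h₁ : x = p.a ∧ y = p.b
  · obtain ⟨rfl, rfl⟩ := h₁
    have k1 : [p.a, p.b].Sublist p.B := pair_sublist_self _ _ _ _
    have k2 : ¬ [p.a, p.b].Sublist p.C := pair_not_sublist _ _ _ _ hC
    have k3 : ¬ [p.a, p.b].Sublist p.B' := pair_not_sublist _ _ _ _ hB'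
    have k4 : [p.a, p.b].Sublist p.C' := pair_sublist_self _ _ _ _
    rw [if_pos k1, if_neg k2, if_neg k3, if_pos k4]
  by_cases h₂ : x = p.b ∧ y = p.a
  · obtain ⟨rfl, rfl⟩ := h₂
    have k1 : ¬ [p.b, p.a].Sublist p.B := pair_not_sublist _ _ _ _ hB
    have k2 : [p.b, p.a].Sublist p.C := pair_sublist_self _ _ _ _
    have k3 : [p.b, p.a].Sublist p.B' := pair_sublist_self _ _ _ _
    have k4 : ¬ [p.b, p.a].Sublist p.C' := pair_not_sublist _ _ _ _ hC'
    rw [if_neg k1, if_pos k2, if_pos k3, if_neg k4]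
  have e1 : [x, y].Sublist p.B ↔ [x, y].Sublist p.B' := pair_sublist_swap _ _ _ _ _ _ h₁ h₂
  have e2 : [x, y].Sublist p.C ↔ [x, y].Sublist p.C' := pair_sublist_swap _ _ _ _ _ _ h₂ h₁
  simp only [e1, e2]

open Classical in
/-- A super-simple DGDD whose blocks are partitioned into swap pairs has the half property. -/
theorem definingHalf_of_swapPairs {X : Type} [DecidableEq X] {groups : Finset (Finset X)}
    (D : DGDD X groups 4 2) (hs : D.SuperSimple) (P : List (SwapPair X))
    (hP : D.blocks = (SwapPair.blocksOf P : Multiset (List X))) : D.DefiningHalf := by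
  rintro S ⟨hS, huniq⟩
  have key : ∀ p ∈ P, p.B ∈ S ∨ p.C ∈ S := by
    intro p hp
    by_contra! hcon
    obtain ⟨P₁, P₂, rfl⟩ := List.append_of_mem hp
    set R : Multiset (List X) :=
      ((SwapPair.blocksOf P₁ ++ SwapPair.blocksOf P₂ : List (List X)) : Multiset (List X)) with hR
    have hdec : D.blocks = p.B ::ₘ p.C ::ₘ R := by
      rw [hP, hR, Multiset.cons_coe, Multiset.cons_coe, Multiset.coe_eq_coe]
      simp only [SwapPair.blocksOf, List.flatMap_append, List.flatMap_cons, List.cons_append,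
        List.nil_append]
      refine List.perm_middle.trans (List.Perm.cons _ ?_)
      exact List.perm_middle
    have hSR : S ≤ R := by
      rw [hdec] at hS
      rwa [Multiset.le_cons_of_notMem hcon.1, Multiset.le_cons_of_notMem hcon.2] at hS
    have hBm : p.B ∈ D.blocks := by rw [hdec]; simp
    have hCm : p.C ∈ D.blocks := by rw [hdec]; simp
    have hRm : ∀ b ∈ R, b ∈ D.blocks := by intro b hb; rw [hdec]; simp [hb]
    have fB : p.B'.toFinset = p.B.toFinset := List.toFinset_eq_of_perm _ _ p.perm_B
    have fC : p.C'.toFinset = p.C.toFinset := List.toFinset_eq_of_perm _ _ p.perm_C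
    let D' : DGDD X groups 4 2 :=
      { blocks := p.B' ::ₘ p.C' ::ₘ R
        len := by
          intro b hb
          simp only [Multiset.mem_cons] at hb
          rcases hb with rfl | rfl | hb
          · rw [p.perm_B.length_eq]; exact D.len _ hBm
          · rw [p.perm_C.length_eq]; exact D.len _ hCm
          · exact D.len _ (hRm _ hb)
        nodup := by
          intro b hb
          simp only [Multiset.mem_cons] at hb
          rcases hb with rfl | rfl | hb
          · exact p.perm_B.nodup_iff.2 (D.nodup _ hBm)
          · exact p.perm_C.nodup_iff.2 (D.nodup _ hCm)
          · exact D.nodup _ (hRm _ hb)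
        transverse := by
          intro b hb
          simp only [Multiset.mem_cons] at hb
          rcases hb with rfl | rfl | hb
          · rw [fB]; exact D.transverse _ hBm
          · rw [fC]; exact D.transverse _ hCm
          · exact D.transverse _ (hRm _ hb)
        covers := by
          intro x y hxy hg
          have h := D.covers x y hxy hg
          rw [hdec] at h
          have hb := swap_balanced p (D.nodup _ hBm) (D.nodup _ hCm) x y
          rw [Multiset.countP_cons, Multiset.countP_cons] at h ⊢
          omega }
    have h' : p.B' ::ₘ p.C' ::ₘ R = D.blocks :=
      huniq D' (hSR.trans ((Multiset.le_cons_self _ _).trans (Multiset.le_cons_self _ _)))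
    have hB'm : p.B' ∈ D.blocks := by rw [← h']; simp
    have hne : p.B' ≠ p.B := by
      intro h
      have hn := D.nodup _ hBm
      have := pair_not_sublist p.a p.b p.l₁ p.l₂ (p.perm_B.nodup_iff.2 hn)
      apply this
      have h2 := pair_sublist_self p.a p.b p.l₁ p.l₂
      have h3 : p.l₁ ++ p.b :: p.a :: p.l₂ = p.l₁ ++ p.a :: p.b :: p.l₂ := h
      rwa [h3]
    have h2 := hs.2 _ hB'm _ hBm hne
    rw [fB, Finset.inter_self, List.toFinset_card_of_nodup (D.nodup _ hBm), D.len _ hBm] at h2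
    omega
  have hle : Multiset.card (D.blocks.filter (· ∈ S)) ≤ Multiset.card S := by
    apply Multiset.card_le_card
    rw [Multiset.le_iff_subset (hs.1.filter _)]
    intro b hb
    exact (Multiset.mem_filter.1 hb).2
  rw [hP] at hle ⊢
  rw [Multiset.filter_coe, Multiset.coe_card] at hle
  rw [Multiset.coe_card]
  have h1 : ∀ P : List (SwapPair X), (SwapPair.blocksOf P).length = 2 * P.length := by
    intro P
    induction P with
    | nil => rfl
    | cons p P ih => simp [SwapPair.blocksOf] at ih ⊢; omega
  have h2 : ∀ P : List (SwapPair X), (∀ p ∈ P, p.B ∈ S ∨ p.C ∈ S) →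
      P.length ≤ ((SwapPair.blocksOf P).filter (fun b => decide (b ∈ S))).length := by
    intro P
    induction P with
    | nil => intro _; simp
    | cons p P ih =>
      intro h
      have h3 := ih fun q hq => h q (List.mem_cons_of_mem _ hq)
      have h4 := h p List.mem_cons_self
      simp only [SwapPair.blocksOf, List.flatMap_cons, List.filter_append, List.length_append,
        List.length_cons] at h3 ⊢
      have : 1 ≤ ([p.B, p.C].filter (fun b => decide (b ∈ S))).length := by
        rw [Nat.one_le_iff_ne_zero, Ne, List.length_eq_zero_iff, List.filter_eq_nil_iff]
        intro h5
        rcases h4 with h4 | h4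
        · exact h5 p.B (by simp) (by simpa using h4)
        · exact h5 p.C (by simp) (by simpa using h4)
      omega
  rw [h1]
  have := h2 P key
  omega

/-- The goal for a given `t`. -/
def Goal (t : ℕ) : Prop :=
    ∃ (groups : Finset (Finset (Fin (3 * t))))
      (D : DGDD (Fin (3 * t)) groups 4 2),
      IsGroupPartition groups ∧ groups.card = t ∧
      (∀ G ∈ groups, G.card = 3) ∧
      D.SuperSimple ∧ D.DefiningHalf

/-- The group of residue `c` mod `t`. -/
def grp (t c : ℕ) : Finset (Fin (3 * t)) := Finset.univ.filter fun x => x.val % t = c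

/-- Development of the base pairs. -/
def develop {X : Type} [Add X] (H : List X) (base : List (SwapPair X)) : List (SwapPair X) :=
  H.flatMap fun h => base.map (SwapPair.shift h)

theorem mem_develop {X : Type} [Add X] (H : List X) (base : List (SwapPair X)) (b : List X) :
    b ∈ SwapPair.blocksOf (develop H base) ↔
      ∃ h ∈ H, ∃ b₀ ∈ SwapPair.blocksOf base, b = b₀.map (· + h) := by
  simp only [SwapPair.blocksOf, develop, List.mem_flatMap, List.mem_map, List.mem_cons,
    List.not_mem_nil, or_false]
  constructor
  · rintro ⟨p, ⟨h, hh, q, hq, rfl⟩, hb⟩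
    rw [SwapPair.shift_B, SwapPair.shift_C] at hb
    rcases hb with rfl | rfl
    · exact ⟨h, hh, _, ⟨q, hq, Or.inl rfl⟩, rfl⟩
    · exact ⟨h, hh, _, ⟨q, hq, Or.inr rfl⟩, rfl⟩
  · rintro ⟨h, hh, b₀, ⟨q, hq, hb₀⟩, rfl⟩
    refine ⟨_, ⟨h, hh, q, hq, rfl⟩, ?_⟩
    rw [SwapPair.shift_B, SwapPair.shift_C]
    rcases hb₀ with rfl | rfl
    · exact Or.inl rfl
    · exact Or.inr rfl

theorem blocksOf_develop_map {X : Type} [AddCommGroup X] (H : List X)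
    (base : List (SwapPair X)) (g : X) :
    (SwapPair.blocksOf (develop H base)).map (List.map (· + g)) =
      SwapPair.blocksOf (develop (H.map (· + g)) base) := by
  simp only [SwapPair.blocksOf, develop, List.flatMap_assoc, List.map_flatMap, List.flatMap_map]
  congr 1; funext h
  congr 1; funext p
  simp [SwapPair.shift_B, SwapPair.shift_C]

theorem develop_perm {X : Type} [AddCommGroup X] (H : List X)
    (base : List (SwapPair X)) (g : X) (hn : H.Nodup) (hadd : ∀ a ∈ H, ∀ b ∈ H, a + b ∈ H)
    (hneg : ∀ a ∈ H, -a ∈ H) (hg : g ∈ H) :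
    ((SwapPair.blocksOf (develop H base)).map (List.map (· + g))).Perm
      (SwapPair.blocksOf (develop H base)) := by
  rw [blocksOf_develop_map]
  have hperm : (H.map (· + g)).Perm H := by
    rw [List.perm_ext_iff_of_nodup (hn.map (add_left_injective g)) hn]
    intro a
    rw [List.mem_map]
    constructor
    · rintro ⟨b, hb, rfl⟩; exact hadd _ hb _ hg
    · intro ha; exact ⟨a + -g, hadd _ ha _ (hneg _ hg), by simp⟩
  exact (hperm.flatMap_right _).flatMap_right _

theorem map_sublist_iff {X : Type} [AddCommGroup X] (g : X) (s l : List X) :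
    (s.map (· + g)).Sublist (l.map (· + g)) ↔ s.Sublist l := by
  constructor
  · intro h
    have := h.map (· + -g)
    simpa [Function.comp_def] using this
  · intro h; exact h.map _

theorem main_construction (t : ℕ) [NeZero (3 * t)] (ht : 0 < t)
    (H R : List (Fin (3 * t))) (base : List (SwapPair (Fin (3 * t))))
    (hn : H.Nodup) (hadd : ∀ a ∈ H, ∀ b ∈ H, a + b ∈ H) (hneg : ∀ a ∈ H, -a ∈ H)
    (hR : ∀ x, ∃ r ∈ R, ∃ h ∈ H, r + h = x)
    (hgrp : ∀ c ∈ Finset.range t, (grp t c).card = 3)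
    (hbase : ∀ b ∈ SwapPair.blocksOf base, b.length = 4 ∧
      b.Pairwise fun x y => x.val % t ≠ y.val % t)
    (hcov : ∀ r ∈ R, ∀ y : Fin (3 * t), y.val % t ≠ r.val % t →
      (SwapPair.blocksOf (develop H base)).countP (fun b => decide ([r, y].Sublist b)) = 2)
    (hcount : ∀ b ∈ SwapPair.blocksOf base,
      (SwapPair.blocksOf (develop H base)).count b ≤ 1)
    (hss : ∀ b ∈ SwapPair.blocksOf base, ∀ c ∈ SwapPair.blocksOf (develop H base),
      (b.filter (fun x => decide (x ∈ c))).length ≤ 2 ∨ b = c) :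
    Goal t := by
  have hmod : ∀ x g : Fin (3 * t), (x + g).val % t = (x.val + g.val) % t := by
    intro x g
    rw [Fin.val_add, Nat.mod_mod_of_dvd _ (Dvd.intro_left 3 rfl)]
  have hmodne : ∀ x y g : Fin (3 * t), x.val % t ≠ y.val % t →
      (x + g).val % t ≠ (y + g).val % t := by
    intro x y g h h'
    rw [hmod, hmod] at h'
    exact h (Nat.ModEq.add_right_cancel' g.val h')
  set M := SwapPair.blocksOf (develop H base) with hM
  have hprops : ∀ b ∈ M, b.length = 4 ∧ b.Pairwise fun x y => x.val % t ≠ y.val % t := by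
    intro b hb
    rw [hM, mem_develop] at hb
    obtain ⟨h, -, b₀, hb₀, rfl⟩ := hb
    obtain ⟨h1, h2⟩ := hbase _ hb₀
    refine ⟨by simpa using h1, ?_⟩
    rw [List.pairwise_map]
    exact h2.imp fun {x y} hxy => hmodne x y h hxy
  have hnod : ∀ b ∈ M, b.Nodup := fun b hb =>
    (hprops b hb).2.imp fun {x y} hxy e => hxy (by rw [e])
  have hinj : ∀ g : Fin (3 * t), Function.Injective (List.map (· + g)) := fun g =>
    List.map_injective_iff.2 (add_left_injective g)
  have hMn : M.Nodup := by
    rw [List.nodup_iff_count_le_one]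
    intro b
    by_cases hb : b ∈ M
    · have hb' := hb
      rw [hM, mem_develop] at hb'
      obtain ⟨h, hh, b₀, hb₀, rfl⟩ := hb'
      rw [← (develop_perm H base h hn hadd hneg hh).count_eq,
        List.count_map_of_injective _ _ (hinj h)]
      exact hcount _ hb₀
    · rw [List.count_eq_zero_of_not_mem hb]; omega
  let groups : Finset (Finset (Fin (3 * t))) := (Finset.range t).image (grp t)
  have hmemg : ∀ x c, x ∈ grp t c ↔ x.val % t = c := by intro x c; simp [grp]
  let D : DGDD (Fin (3 * t)) groups 4 2 :=
    { blocks := (M : Multiset (List (Fin (3 * t))))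
      len := fun b hb => (hprops b hb).1
      nodup := fun b hb => hnod b hb
      transverse := by
        intro b hb G hG
        obtain ⟨c, -, rfl⟩ := Finset.mem_image.1 hG
        rw [Finset.card_le_one]
        intro x hx y hy
        rw [Finset.mem_inter, List.mem_toFinset, hmemg] at hx hy
        by_contra hxy
        haveI : Std.Symm (fun x y : Fin (3 * t) => x.val % t ≠ y.val % t) := ⟨fun _ _ h => h.symm⟩
        exact (List.Pairwise.forall (R := fun x y : Fin (3 * t) => x.val % t ≠ y.val % t)
          (hprops b hb).2 hx.1 hy.1 hxy) (hx.2.trans hy.2.symm)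
      covers := by
        intro x y hxy hg
        have hne : y.val % t ≠ x.val % t := by
          intro h
          exact hg (grp t (x.val % t)) (Finset.mem_image_of_mem _
            (Finset.mem_range.2 (Nat.mod_lt _ ht))) ⟨(hmemg _ _).2 rfl, (hmemg _ _).2 h⟩
        obtain ⟨r, hr, h, hh, rfl⟩ := hR x
        have h1 := hcov r hr (y - h) (by
          intro e
          apply hne
          rw [← sub_add_cancel y h, hmod, hmod, Nat.add_mod, e, ← Nat.add_mod])
        rw [Multiset.coe_countP,
          ← (develop_perm H base h hn hadd hneg hh).countP_eq, List.countP_map, ← h1]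
        congr 1
        funext b
        simp only [Function.comp]
        rw [decide_eq_decide, ← map_sublist_iff h [r, y - h] b]
        simp }
  have hD : D.SuperSimple := by
    refine ⟨hMn, ?_⟩
    intro b₁ h₁ b₂ h₂ hne
    have h₁' : b₁ ∈ M := h₁
    have h₂' : b₂ ∈ M := h₂
    rw [hM, mem_develop] at h₁'
    obtain ⟨h, hh, b₀, hb₀, rfl⟩ := h₁'
    rw [← (develop_perm H base h hn hadd hneg hh).mem_iff, List.mem_map] at h₂'
    obtain ⟨c, hc, rfl⟩ := h₂'
    have h3 := (hss b₀ hb₀ c hc).resolve_right (fun e => hne (by rw [e]))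
    refine le_trans ?_ h3
    have : (List.map (· + h) b₀).toFinset ∩ (List.map (· + h) c).toFinset ⊆
        ((b₀.filter (fun x => decide (x ∈ c))).map (· + h)).toFinset := by
      intro x
      simp only [Finset.mem_inter, List.mem_toFinset, List.mem_map, List.mem_filter,
        decide_eq_true_eq]
      rintro ⟨⟨u, hu, rfl⟩, v, hv, e⟩
      obtain rfl : v = u := add_left_injective h e
      exact ⟨v, ⟨hu, hv⟩, rfl⟩
    refine (Finset.card_le_card this).trans ((List.toFinset_card_le _).trans ?_)
    simp
  refine ⟨groups, D, ?_, ?_, ?_, hD, definingHalf_of_swapPairs D hD _ rfl⟩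
  · intro x
    refine ⟨grp t (x.val % t), ⟨Finset.mem_image_of_mem _
      (Finset.mem_range.2 (Nat.mod_lt _ ht)), (hmemg _ _).2 rfl⟩, ?_⟩
    rintro G ⟨hG, hx⟩
    obtain ⟨c, -, rfl⟩ := Finset.mem_image.1 hG
    rw [(hmemg _ _).1 hx]
  · have : (Finset.image (grp t) (Finset.range t)).card = (Finset.range t).card := by
      apply Finset.card_image_of_injOn
      intro c hc d hd e
      have hc' : c < t := by simpa using hc
      have h1 : (⟨c, by omega⟩ : Fin (3 * t)) ∈ grp t c := (hmemg _ _).2 (Nat.mod_eq_of_lt hc')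
      have e' : grp t c = grp t d := e
      rw [e', hmemg] at h1
      rw [← h1]
      exact (Nat.mod_eq_of_lt hc').symm
    rw [Finset.card_range] at this
    exact this
  · intro G hG
    obtain ⟨c, hc, rfl⟩ := Finset.mem_image.1 hG
    exact hgrp c hc

/-- Base trade pairs for `t = 6`. -/
def base6 : List (SwapPair (Fin (3 * 6))) :=
  [⟨[], 0, 4, [9, 11], [8, 1], []⟩,
   ⟨[], 1, 5, [10, 12], [9, 2], []⟩,
   ⟨[], 0, 9, [1, 16], [], [10, 7]⟩,
   ⟨[0], 2, 15, [1], [12], [10]⟩,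
   ⟨[1], 3, 16, [2], [13], [11]⟩]

theorem case6 : Goal 6 := by
  refine main_construction 6 (by norm_num) [0, 2, 4, 6, 8, 10, 12, 14, 16] [0, 1] base6
    (by decide +kernel) (by decide +kernel) (by decide +kernel) (by decide +kernel)
    (by decide +kernel) (by decide +kernel) (by decide +kernel) (by decide +kernel)
    (by decide +kernel)

/-- Base trade pairs for `t = 7`. -/
def base7 : List (SwapPair (Fin (3 * 7))) :=
  [⟨[], 0, 2, [12, 15], [], [8, 17]⟩,
   ⟨[0], 16, 5, [6], [], [13, 4]⟩,
   ⟨[0, 13], 16, 17, [], [12], [14]⟩]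

theorem case7 : Goal 7 := by
  refine main_construction 7 (by norm_num) [0, 1, 2, 3, 4, 5, 6, 7, 8, 9, 10, 11, 12, 13, 14, 15, 16, 17, 18, 19, 20] [0] base7
    (by decide +kernel) (by decide +kernel) (by decide +kernel) (by decide +kernel)
    (by decide +kernel) (by decide +kernel) (by decide +kernel) (by decide +kernel)
    (by decide +kernel)

/-- Base trade pairs for `t = 8`. -/
def base8 : List (SwapPair (Fin (3 * 8))) :=
  [⟨[], 0, 3, [18, 15], [9, 12], []⟩,
   ⟨[0, 12], 17, 19, [], [15], [4]⟩,
   ⟨[1, 13], 18, 20, [], [16], [5]⟩,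
   ⟨[], 0, 14, [19, 20], [4, 15], []⟩,
   ⟨[], 1, 15, [20, 21], [5, 16], []⟩,
   ⟨[0, 17], 6, 7, [], [], [10, 4]⟩,
   ⟨[1, 18], 7, 8, [], [], [11, 5]⟩]

theorem case8 : Goal 8 := by
  refine main_construction 8 (by norm_num) [0, 2, 4, 6, 8, 10, 12, 14, 16, 18, 20, 22] [0, 1] base8
    (by decide +kernel) (by decide +kernel) (by decide +kernel) (by decide +kernel)
    (by decide +kernel) (by decide +kernel) (by decide +kernel) (by decide +kernel)
    (by decide +kernel)

/-- Base trade pairs for `t = 9`. -/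
def base9 : List (SwapPair (Fin (3 * 9))) :=
  [⟨[], 0, 3, [6, 17], [4], [23]⟩,
   ⟨[0, 4], 2, 21, [], [14, 24], []⟩,
   ⟨[], 0, 20, [5, 21], [25], [6]⟩,
   ⟨[], 0, 11, [12, 25], [1, 23], []⟩]

theorem case9 : Goal 9 := by
  refine main_construction 9 (by norm_num) [0, 1, 2, 3, 4, 5, 6, 7, 8, 9, 10, 11, 12, 13, 14, 15, 16, 17, 18, 19, 20, 21, 22, 23, 24, 25, 26] [0] base9
    (by decide +kernel) (by decide +kernel) (by decide +kernel) (by decide +kernel)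
    (by decide +kernel) (by decide +kernel) (by decide +kernel) (by decide +kernel)
    (by decide +kernel)

/-- Base trade pairs for `t = 13`. -/
def base13 : List (SwapPair (Fin (3 * 13))) :=
  [⟨[0, 32], 3, 24, [], [27, 8], []⟩,
   ⟨[0, 8], 30, 6, [], [36, 2], []⟩,
   ⟨[0, 2], 27, 21, [], [9, 20], []⟩,
   ⟨[0], 20, 37, [23], [6, 8], []⟩,
   ⟨[0], 11, 34, [38], [15, 20], []⟩,
   ⟨[0], 8, 7, [17], [18, 11], []⟩]

theorem case13 : Goal 13 := by
  refine main_construction 13 (by norm_num) [0, 1, 2, 3, 4, 5, 6, 7, 8, 9, 10, 11, 12, 13, 14, 15, 16, 17, 18, 19, 20, 21, 22, 23, 24, 25, 26, 27, 28, 29, 30, 31, 32, 33, 34, 35, 36, 37, 38] [0] base13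
    (by decide +kernel) (by decide +kernel) (by decide +kernel) (by decide +kernel)
    (by decide +kernel) (by decide +kernel) (by decide +kernel) (by decide +kernel)
    (by decide +kernel)

/-- For every `t ∈ {6,7,8,9,13}` there exists a super-simple `(4,2)`-DGDD of type `3^t` in which every defining set contains at least half of the blocks. -/
theorem exists_superSimple_DGDD_type_three_pow (t : ℕ) (ht : t ∈ ({6, 7, 8, 9, 13} : Finset ℕ)) :
    ∃ (groups : Finset (Finset (Fin (3 * t))))
      (D : DGDD (Fin (3 * t)) groups 4 2),
      IsGroupPartition groups ∧ groups.card = t ∧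
      (∀ G ∈ groups, G.card = 3) ∧
      D.SuperSimple ∧ D.DefiningHalf := by
  rw [Finset.mem_insert, Finset.mem_insert, Finset.mem_insert, Finset.mem_insert,
    Finset.mem_singleton] at ht
  rcases ht with rfl | rfl | rfl | rfl | rfl
  · exact case6
  · exact case7
  · exact case8
  · exact case9
  · exact case13
end

section
/- For every t ∈ {4, 5, 6, 13, 19, 22} there exists a super-simple (4,2)-DGDD of type t^4 in which every defining set contains at least half of the blocks. -/
namespace DGDDConstruction

/-- The point with value `a` in the group number `i`. -/
def pt {t : ℕ} (i : Fin 4) (a : Fin t) : Fin (4 * t) := finProdFinEquiv (i, a)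

theorem pt_inj {t : ℕ} (i j : Fin 4) (a b : Fin t) : pt i a = pt j b ↔ i = j ∧ a = b := by
  simp [pt]

theorem pt_surj {t : ℕ} (x : Fin (4 * t)) : ∃ i a, x = pt i a := by
  obtain ⟨⟨i, a⟩, h⟩ := (finProdFinEquiv (m := 4) (n := t)).surjective x
  exact ⟨i, a, h.symm⟩

/-- The `i`-th group. -/
def grp (t : ℕ) (i : Fin 4) : Finset (Fin (4 * t)) := Finset.univ.image (pt i)

theorem mem_grp {t : ℕ} (i j : Fin 4) (a : Fin t) : pt j a ∈ grp t i ↔ j = i := by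
  simp only [grp, Finset.mem_image, Finset.mem_univ, true_and, pt_inj]
  constructor
  · rintro ⟨b, h, -⟩; exact h.symm
  · rintro rfl; exact ⟨a, rfl, rfl⟩

/-- The collection of the four groups. -/
def grps (t : ℕ) : Finset (Finset (Fin (4 * t))) := Finset.univ.image (grp t)

theorem card_grp (t : ℕ) (i : Fin 4) : (grp t i).card = t := by
  rw [grp, Finset.card_image_of_injective]
  · simp
  · intro a b h; exact ((pt_inj _ _ _ _).1 h).2

theorem card_grps (t : ℕ) [NeZero t] : (grps t).card = 4 := by
  rw [grps, Finset.card_image_of_injective]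
  · simp
  · intro i j h
    have : pt i (0 : Fin t) ∈ grp t j := by rw [← h, mem_grp]
    exact (mem_grp _ _ _).1 this

theorem grps_partition (t : ℕ) : IsGroupPartition (grps t) := by
  intro x
  obtain ⟨i, a, rfl⟩ := pt_surj x
  refine ⟨grp t i, ⟨by simp [grps], by simp [mem_grp]⟩, ?_⟩
  rintro G ⟨hG, hx⟩
  simp only [grps, Finset.mem_image, Finset.mem_univ, true_and] at hG
  obtain ⟨j, rfl⟩ := hG
  rw [mem_grp] at hx
  rw [hx]

/-- Blocks of the first half are ordered by increasing group number, those of the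
second half by decreasing group number. -/
def blk {t : ℕ} (β : Bool) (w : Fin 4 → Fin t) : List (Fin (4 * t)) :=
  if β then [pt 3 (w 3), pt 2 (w 2), pt 1 (w 1), pt 0 (w 0)]
  else [pt 0 (w 0), pt 1 (w 1), pt 2 (w 2), pt 3 (w 3)]

/-- The same block with the points in groups `0` and `1` interchanged. -/
def blk' {t : ℕ} (β : Bool) (w : Fin 4 → Fin t) : List (Fin (4 * t)) :=
  if β then [pt 3 (w 3), pt 2 (w 2), pt 0 (w 0), pt 1 (w 1)]
  else [pt 1 (w 1), pt 0 (w 0), pt 2 (w 2), pt 3 (w 3)]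

theorem blk_toFinset {t : ℕ} (β : Bool) (w : Fin 4 → Fin t) :
    (blk β w).toFinset = Finset.univ.image (fun i => pt i (w i)) := by
  ext x
  cases β <;> simp [blk, Fin.exists_fin_succ, eq_comm] <;> tauto

theorem blk'_toFinset {t : ℕ} (β : Bool) (w : Fin 4 → Fin t) :
    (blk' β w).toFinset = Finset.univ.image (fun i => pt i (w i)) := by
  ext x
  cases β <;> simp [blk', Fin.exists_fin_succ, eq_comm] <;> tauto

theorem image_inter_grp {t : ℕ} (w : Fin 4 → Fin t) (G) (hG : G ∈ grps t) :
    ((Finset.univ.image (fun i => pt i (w i))) ∩ G).card ≤ 1 := by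
  simp only [grps, Finset.mem_image, Finset.mem_univ, true_and] at hG
  obtain ⟨j, rfl⟩ := hG
  rw [Finset.card_le_one]
  intro a ha b hb
  simp only [Finset.mem_inter, Finset.mem_image, Finset.mem_univ, true_and] at ha hb
  obtain ⟨⟨i, rfl⟩, hi⟩ := ha
  obtain ⟨⟨k, rfl⟩, hk⟩ := hb
  rw [mem_grp] at hi hk
  rw [hi, hk]

theorem blk_inter {t : ℕ} (β β' : Bool) (w w' : Fin 4 → Fin t) :
    ((blk β w).toFinset ∩ (blk β' w').toFinset).card
      ≤ (Finset.univ.filter (fun i => w i = w' i)).card := by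
  rw [blk_toFinset, blk_toFinset]
  refine le_trans (Finset.card_le_card ?_)
    (Finset.card_image_le (s := Finset.univ.filter (fun i => w i = w' i))
      (f := fun i => pt i (w i)))
  intro x hx
  simp only [Finset.mem_inter, Finset.mem_image, Finset.mem_univ, true_and,
    Finset.mem_filter] at hx ⊢
  obtain ⟨⟨i, rfl⟩, j, h⟩ := hx
  rw [pt_inj] at h
  obtain ⟨rfl, h⟩ := h
  exact ⟨j, h.symm, rfl⟩

theorem blk_len {t : ℕ} (β : Bool) (w : Fin 4 → Fin t) : (blk β w).length = 4 := by
  cases β <;> rfl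

theorem blk'_len {t : ℕ} (β : Bool) (w : Fin 4 → Fin t) : (blk' β w).length = 4 := by
  cases β <;> rfl

theorem blk_nodup {t : ℕ} (β : Bool) (w : Fin 4 → Fin t) : (blk β w).Nodup := by
  cases β <;> simp [blk, pt_inj]

theorem blk'_nodup {t : ℕ} (β : Bool) (w : Fin 4 → Fin t) : (blk' β w).Nodup := by
  cases β <;> simp [blk', pt_inj]

theorem blk'_ne {t : ℕ} (β β' : Bool) (w w' : Fin 4 → Fin t) : blk' β w ≠ blk β' w' := by
  cases β <;> cases β' <;> simp [blk, blk', pt_inj]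

theorem blk_inj {t : ℕ} (β β' : Bool) (w w' : Fin 4 → Fin t) (h : blk β w = blk β' w') :
    β = β' ∧ w = w' := by
  cases β <;> cases β' <;> simp [blk, pt_inj, funext_iff, Fin.forall_fin_succ] at h ⊢ <;> tauto

theorem pair_sublist {α : Type*} (x y a b c d : α) :
    [x, y].Sublist [a, b, c, d] ↔
      (x = a ∧ (y = b ∨ y = c ∨ y = d)) ∨ (x = b ∧ (y = c ∨ y = d)) ∨ (x = c ∧ y = d) := by
  simp only [List.sublist_cons_iff, List.cons.injEq, List.sublist_nil, reduceCtorEq]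
  simp
  grind

theorem sublist_blk {t : ℕ} (w : Fin 4 → Fin t) (i j : Fin 4) (x y : Fin t) (β : Bool) :
    [pt i x, pt j y].Sublist (blk β w) ↔
      (if β then j < i else i < j) ∧ w i = x ∧ w j = y := by
  cases β <;> simp only [blk, if_true, if_false, Bool.false_eq_true, pair_sublist, pt_inj] <;>
    fin_cases i <;> fin_cases j <;> simp [eq_comm]

/-- Interchanging the two adjacent points in both blocks is a trade. -/
theorem trade_count {t : ℕ} (w w' : Fin 4 → Fin t) (h0 : w 0 = w' 0) (h1 : w 1 = w' 1)
    (x y : Fin (4 * t)) :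
    ({blk' false w, blk' true w'} : Multiset (List (Fin (4 * t)))).countP
        (fun b => [x, y].Sublist b)
      = ({blk false w, blk true w'} : Multiset (List (Fin (4 * t)))).countP
        (fun b => [x, y].Sublist b) := by
  obtain ⟨i, x, rfl⟩ := pt_surj x
  obtain ⟨j, y, rfl⟩ := pt_surj y
  simp only [Multiset.insert_eq_cons, ← Multiset.cons_zero, Multiset.countP_cons,
    Multiset.countP_zero, blk, blk', if_true, if_false, Bool.false_eq_true, pair_sublist, pt_inj,
    h0, h1]
  fin_cases i <;> fin_cases j <;> simp [add_comm]

section main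

variable {t : ℕ} {ι : Type} [Fintype ι] [DecidableEq ι]

/-- The block collection. -/
def blocks (F : Bool → ι → Fin 4 → Fin t) : Multiset (List (Fin (4 * t))) :=
  (Finset.univ : Finset (Bool × ι)).val.map (fun q => blk q.1 (F q.1 q.2))

theorem mem_blocks (F : Bool → ι → Fin 4 → Fin t) (b) :
    b ∈ blocks F ↔ ∃ β s, blk β (F β s) = b := by
  simp [blocks]

theorem count_blocks (F : Bool → ι → Fin 4 → Fin t)
    (hcov : ∀ β i j, i ≠ j → ∀ x y,
      (Finset.univ.filter (fun s => F β s i = x ∧ F β s j = y)).card = 2)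
    (x y : Fin (4 * t)) (hG : ∀ G ∈ grps t, ¬(x ∈ G ∧ y ∈ G)) :
    (blocks F).countP (fun b => [x, y].Sublist b) = 2 := by
  obtain ⟨i, x, rfl⟩ := pt_surj x
  obtain ⟨j, y, rfl⟩ := pt_surj y
  have hij : i ≠ j := by
    rintro rfl
    exact hG (grp t i) (by simp [grps]) (by simp [mem_grp])
  rw [blocks, Multiset.countP_map]
  simp only [sublist_blk]
  rw [← Finset.filter_val, Finset.card_val]
  rcases lt_or_gt_of_ne hij with h | h
  · rw [← hcov false i j hij x y]
    refine Finset.card_bij' (fun q _ => q.2) (fun s _ => (false, s)) ?_ ?_ ?_ ?_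
    · rintro ⟨β, s⟩ hq
      cases β <;> simp [h, h.not_gt] at hq ⊢ <;> exact hq
    · intro s hs
      simpa [h] using hs
    · rintro ⟨β, s⟩ hq
      cases β <;> simp [h, h.not_gt] at hq ⊢
    · intro s hs
      rfl
  · rw [← hcov true i j hij x y]
    refine Finset.card_bij' (fun q _ => q.2) (fun s _ => (true, s)) ?_ ?_ ?_ ?_
    · rintro ⟨β, s⟩ hq
      cases β <;> simp [h, h.not_gt] at hq ⊢ <;> exact hq
    · intro s hs
      simpa [h] using hs
    · rintro ⟨β, s⟩ hq
      cases β <;> simp [h, h.not_gt] at hq ⊢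
    · intro s hs
      rfl

theorem blocks_nodup (F : Bool → ι → Fin 4 → Fin t)
    (hinj : ∀ β, Function.Injective (F β)) : (blocks F).Nodup := by
  refine Multiset.Nodup.map ?_ Finset.univ.nodup
  rintro ⟨β, s⟩ ⟨β', s'⟩ h
  obtain ⟨h1, h2⟩ := blk_inj _ _ _ _ h
  dsimp only at h1 h2
  subst h1
  rw [hinj β h2]

theorem main_abstract [NeZero t] (F : Bool → ι → Fin 4 → Fin t)
    (hcov : ∀ β i j, i ≠ j → ∀ x y,
      (Finset.univ.filter (fun s => F β s i = x ∧ F β s j = y)).card = 2)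
    (hss : ∀ β β' s s', (β, s) ≠ (β', s') →
      (Finset.univ.filter (fun i => F β s i = F β' s' i)).card ≤ 2)
    (h0 : ∀ s, F false s 0 = F true s 0) (h1 : ∀ s, F false s 1 = F true s 1) :
    ∃ (groups : Finset (Finset (Fin (4 * t))))
      (D : DGDD (Fin (4 * t)) groups 4 2),
      IsGroupPartition groups ∧ groups.card = 4 ∧
      (∀ G ∈ groups, G.card = t) ∧
      D.SuperSimple ∧ D.DefiningHalf := by
  have hinj : ∀ β, Function.Injective (F β) := by
    intro β s s' h
    by_contra hne
    have := hss β β s s' (by simpa using hne)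
    simp [h] at this
  have hnd := blocks_nodup F hinj
  let D : DGDD (Fin (4 * t)) (grps t) 4 2 :=
    { blocks := blocks F
      len := by
        intro b hb
        obtain ⟨β, s, rfl⟩ := (mem_blocks F b).1 hb
        exact blk_len _ _
      nodup := by
        intro b hb
        obtain ⟨β, s, rfl⟩ := (mem_blocks F b).1 hb
        exact blk_nodup _ _
      transverse := by
        intro b hb
        obtain ⟨β, s, rfl⟩ := (mem_blocks F b).1 hb
        rw [blk_toFinset]
        exact image_inter_grp _
      covers := fun x y _ hG => count_blocks F hcov x y hG }
  refine ⟨grps t, D, grps_partition t, card_grps t, ?_, ⟨hnd, ?_⟩, ?_⟩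
  · intro G hG
    simp only [grps, Finset.mem_image, Finset.mem_univ, true_and] at hG
    obtain ⟨i, rfl⟩ := hG
    exact card_grp t i
  · intro b hb b' hb' hne
    obtain ⟨β, s, rfl⟩ := (mem_blocks F b).1 hb
    obtain ⟨β', s', rfl⟩ := (mem_blocks F b').1 hb'
    refine (blk_inter _ _ _ _).trans (hss β β' s s' ?_)
    intro h
    apply hne
    rw [Prod.mk.injEq] at h
    obtain ⟨rfl, rfl⟩ := h
    rfl
  · rintro S ⟨hS, hdef⟩
    change S ≤ blocks F at hS
    change (blocks F).card ≤ 2 * S.card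
    have hcard : (blocks F).card = 2 * Fintype.card ι := by simp [blocks]
    rw [hcard]
    by_contra hlt
    have hlt : S.card < Fintype.card ι := by omega
    have hex : ∃ s, blk false (F false s) ∉ S ∧ blk true (F true s) ∉ S := by
      by_contra hcon
      push Not at hcon
      have hsel : ∀ s, ∃ β, blk β (F β s) ∈ S := by
        intro s
        by_cases h : blk false (F false s) ∈ S
        · exact ⟨_, h⟩
        · exact ⟨_, hcon s h⟩
      choose β hβ using hsel
      have : Fintype.card ι ≤ S.toFinset.card := by
        rw [← Finset.card_univ]
        refine Finset.card_le_card_of_injOn (fun s => blk (β s) (F (β s) s)) ?_ ?_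
        · intro s _
          simpa using hβ s
        · intro s _ s' _ h
          obtain ⟨e1, e2⟩ := blk_inj _ _ _ _ h
          rw [e1] at e2
          exact hinj _ e2
      have := S.toFinset_card_le
      omega
    obtain ⟨s, hs0, hs1⟩ := hex
    have hne : blk true (F true s) ≠ blk false (F false s) := by
      intro h
      have := (blk_inj _ _ _ _ h).1
      simp at this
    set T := ((blocks F).erase (blk false (F false s))).erase (blk true (F true s)) with hT
    have hdec : blocks F = T + {blk false (F false s), blk true (F true s)} := by
      rw [Multiset.insert_eq_cons, Multiset.add_cons, add_comm, Multiset.singleton_add, hT,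
        Multiset.cons_erase, Multiset.cons_erase]
      · exact (mem_blocks _ _).2 ⟨_, _, rfl⟩
      · rw [Multiset.mem_erase_of_ne hne]
        exact (mem_blocks _ _).2 ⟨_, _, rfl⟩
    have hTle : T ≤ blocks F := (Multiset.erase_le _ _).trans (Multiset.erase_le _ _)
    have hST : S ≤ T := by
      have e0 := Multiset.erase_le_erase (blk false (F false s)) hS
      rw [Multiset.erase_of_notMem hs0] at e0
      have e1 := Multiset.erase_le_erase (blk true (F true s)) e0
      rwa [Multiset.erase_of_notMem hs1] at e1
    let T' := T + {blk' false (F false s), blk' true (F true s)}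
    have hmem : ∀ b ∈ T', (∃ β w, b = blk β w) ∨ (∃ β w, b = blk' β w) := by
      intro b hb
      rcases Multiset.mem_add.1 hb with hb | hb
      · obtain ⟨β, s, rfl⟩ := (mem_blocks F b).1 (Multiset.mem_of_le hTle hb)
        exact Or.inl ⟨_, _, rfl⟩
      · right
        simp only [Multiset.insert_eq_cons, Multiset.mem_cons, Multiset.mem_singleton] at hb
        rcases hb with rfl | rfl
        · exact ⟨_, _, rfl⟩
        · exact ⟨_, _, rfl⟩
    let D' : DGDD (Fin (4 * t)) (grps t) 4 2 :=
      { blocks := T'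
        len := by
          intro b hb
          rcases hmem b hb with ⟨β, w, rfl⟩ | ⟨β, w, rfl⟩
          · exact blk_len _ _
          · exact blk'_len _ _
        nodup := by
          intro b hb
          rcases hmem b hb with ⟨β, w, rfl⟩ | ⟨β, w, rfl⟩
          · exact blk_nodup _ _
          · exact blk'_nodup _ _
        transverse := by
          intro b hb
          rcases hmem b hb with ⟨β, w, rfl⟩ | ⟨β, w, rfl⟩
          · rw [blk_toFinset]
            exact image_inter_grp _
          · rw [blk'_toFinset]
            exact image_inter_grp _
        covers := by
          intro x y _ hG
          rw [← count_blocks F hcov x y hG, hdec, Multiset.countP_add, Multiset.countP_add,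
            trade_count _ _ (h0 s) (h1 s)] }
    have heq : T' = blocks F := hdef D' (hST.trans (Multiset.le_add_right _ _))
    have hb : blk' false (F false s) ∈ T' := by simp [T']
    rw [heq] at hb
    obtain ⟨β, s', h⟩ := (mem_blocks F _).1 hb
    exact blk'_ne _ _ _ _ h.symm

end main

/-- Developing a pair of difference matrices with `2t` columns over `Fin t`. -/
theorem main_diff (t : ℕ) [NeZero t] (d : Bool → Fin (2 * t) → Fin 4 → Fin t)
    (hcov : ∀ β i j, i < j → ∀ c,
      (Finset.univ.filter (fun k => d β k j - d β k i = c)).card = 2)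
    (hss : ∀ β β' k k', (β, k) ≠ (β', k') → ∀ i₀,
      (Finset.univ.filter (fun i => d β k i - d β' k' i = d β k i₀ - d β' k' i₀)).card ≤ 2)
    (h0 : ∀ k, d false k 0 = d true k 0) (h1 : ∀ k, d false k 1 = d true k 1) :
    ∃ (groups : Finset (Finset (Fin (4 * t))))
      (D : DGDD (Fin (4 * t)) groups 4 2),
      IsGroupPartition groups ∧ groups.card = 4 ∧
      (∀ G ∈ groups, G.card = t) ∧
      D.SuperSimple ∧ D.DefiningHalf := by
  have key : ∀ β i j, i < j → ∀ x y, (Finset.univ.filter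
      (fun s : Fin t × Fin (2 * t) => s.1 + d β s.2 i = x ∧ s.1 + d β s.2 j = y)).card = 2 := by
    intro β i j hij x y
    refine Eq.trans ?_ (hcov β i j hij (y - x))
    refine Finset.card_bij' (fun s _ => s.2) (fun k _ => (x - d β k i, k)) ?_ ?_ ?_ ?_
    · rintro ⟨g, k⟩ h
      simp only [Finset.mem_filter, Finset.mem_univ, true_and] at h ⊢
      rw [← h.1, ← h.2]; abel
    · intro k h
      simp only [Finset.mem_filter, Finset.mem_univ, true_and] at h ⊢
      refine ⟨by abel, ?_⟩
      rw [sub_add_eq_add_sub, add_sub_assoc, h]; abel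
    · rintro ⟨g, k⟩ h
      simp only [Finset.mem_filter, Finset.mem_univ, true_and] at h ⊢
      rw [← h.1, add_sub_cancel_right]
    · intro k h
      rfl
  refine main_abstract (ι := Fin t × Fin (2 * t)) (fun β s i => s.1 + d β s.2 i) ?_ ?_ ?_ ?_
  · intro β i j hij x y
    rcases lt_or_gt_of_ne hij with h | h
    · exact key β i j h x y
    · simpa only [and_comm] using key β j i h y x
  · rintro β β' ⟨g, k⟩ ⟨g', k'⟩ hne
    by_contra hcon
    have hpos : 0 < (Finset.univ.filter (fun i => g + d β k i = g' + d β' k' i)).card := by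
      dsimp only at hcon
      omega
    obtain ⟨i₀, hi₀⟩ := Finset.card_pos.1 hpos
    simp only [Finset.mem_filter, Finset.mem_univ, true_and] at hi₀
    by_cases hk : (β, k) = (β', k')
    · rw [Prod.mk.injEq] at hk
      obtain ⟨rfl, rfl⟩ := hk
      exact hne (by rw [add_right_cancel hi₀])
    · apply hcon
      refine le_trans (Finset.card_le_card ?_) (hss β β' k k' hk i₀)
      intro i hi
      simp only [Finset.mem_filter, Finset.mem_univ, true_and] at hi ⊢
      rw [sub_eq_sub_iff_add_eq_add]
      have e1 : d β k i = g' + d β' k' i - g := by rw [← hi]; abel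
      have e2 : d β k i₀ = g' + d β' k' i₀ - g := by rw [← hi₀]; abel
      rw [e1, e2]; abel
  · intro s; simp only [h0]
  · intro s; simp only [h1]

/-- The difference of two entries modulo `t`. -/
def df (t a b : ℕ) : ℕ := (t - b % t + a % t) % t

/-- No three of four numbers are equal. -/
def noThree (a b c e : ℕ) : Bool :=
  !((a == b && (a == c || a == e)) || (c == e && (a == c || b == c)))

/-- Every difference of the rows `i` and `j` occurs exactly twice. -/
def chkRows (t : ℕ) (d : Bool → ℕ → ℕ → ℕ) (β : Bool) (i j : ℕ) : Bool :=
  (List.range t).all fun c =>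
    (List.range (2 * t)).countP (fun k => df t (d β k j) (d β k i) == c) == 2

/-- Both arrays are difference matrices. -/
def chkCov (t : ℕ) (d : Bool → ℕ → ℕ → ℕ) : Bool :=
  [false, true].all fun β => (List.range 4).all fun j => (List.range j).all fun i =>
    chkRows t d β i j

/-- No two different columns agree, up to a translation, in three rows. -/
def chkSS (t : ℕ) (d : Bool → ℕ → ℕ → ℕ) : Bool :=
  [false, true].all fun β => [false, true].all fun β' =>
    (List.range (2 * t)).all fun k => (List.range (2 * t)).all fun k' =>
      (β == β' && k == k') ||
        noThree (df t (d β k 0) (d β' k' 0)) (df t (d β k 1) (d β' k' 1))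
          (df t (d β k 2) (d β' k' 2)) (df t (d β k 3) (d β' k' 3))

/-- Both arrays agree in the row `i`. -/
def chkEq (t : ℕ) (d : Bool → ℕ → ℕ → ℕ) (i : ℕ) : Bool :=
  (List.range (2 * t)).all fun k => d false k i == d true k i

theorem card_filter_le_two_of_noThree (e : Fin 4 → ℕ) (c : ℕ)
    (h : noThree (e 0) (e 1) (e 2) (e 3) = true) :
    (Finset.univ.filter (fun i => e i = c)).card ≤ 2 := by
  rw [Finset.card_filter, Fin.sum_univ_four]
  simp only [noThree] at h
  grind

theorem card_filter_fin (n : ℕ) (P : ℕ → Bool) :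
    (Finset.univ.filter (fun k : Fin n => P k.val = true)).card = (List.range n).countP P := by
  rw [Finset.card_filter, Fin.sum_univ_eq_sum_range (fun k => if P k = true then 1 else 0),
    ← Finset.card_filter, List.countP_eq_length_filter]
  simp [Finset.card, Finset.filter, Finset.range, Multiset.range]

theorem val_sub {t : ℕ} [NeZero t] (a b : ℕ) :
    (Fin.ofNat t a - Fin.ofNat t b).val = df t a b := by
  rw [Fin.sub_def]
  rfl

/-- The numerical form of the difference matrix construction. -/
theorem main_check (t : ℕ) [NeZero t] (d : Bool → ℕ → ℕ → ℕ) (hc : chkCov t d = true)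
    (hs : chkSS t d = true) (h0 : chkEq t d 0 = true) (h1 : chkEq t d 1 = true) :
    ∃ (groups : Finset (Finset (Fin (4 * t))))
      (D : DGDD (Fin (4 * t)) groups 4 2),
      IsGroupPartition groups ∧ groups.card = 4 ∧
      (∀ G ∈ groups, G.card = t) ∧
      D.SuperSimple ∧ D.DefiningHalf := by
  refine main_diff t (fun β k i => Fin.ofNat t (d β k.val i.val)) ?_ ?_ ?_ ?_
  · intro β i j hij c
    simp only [chkCov, chkRows, List.all_eq_true, List.mem_range, beq_iff_eq] at hc
    refine Eq.trans ?_ (hc β (by cases β <;> simp) j.val j.isLt i.val hij c.val c.isLt)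
    rw [← card_filter_fin]
    congr 1
    ext k
    simp only [Finset.mem_filter, Finset.mem_univ, true_and, beq_iff_eq]
    rw [Fin.ext_iff, val_sub]
  · intro β β' k k' hne i₀
    simp only [chkSS, List.all_eq_true, List.mem_range, Bool.or_eq_true, Bool.and_eq_true,
      beq_iff_eq] at hs
    have h := (hs β (by cases β <;> simp) β' (by cases β' <;> simp) k.val k.isLt k'.val
      k'.isLt).resolve_left (by
        rintro ⟨rfl, h⟩
        exact hne (by rw [Fin.ext h]))
    simp only [Fin.ext_iff, val_sub]
    exact card_filter_le_two_of_noThree (fun i => df t (d β k.val i.val) (d β' k'.val i.val)) _ h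
  · intro k
    simp only [chkEq, List.all_eq_true, List.mem_range, beq_iff_eq] at h0
    exact congrArg _ (h0 k.val k.isLt)
  · intro k
    simp only [chkEq, List.all_eq_true, List.mem_range, beq_iff_eq] at h1
    exact congrArg _ (h1 k.val k.isLt)

/-- The difference matrices for `t = 4`, found by computer search. -/
def d4 (β : Bool) (k i : ℕ) : ℕ :=
  ([[], [0, 0, 1, 1, 2, 2, 3, 3],
    if β then [1, 2, 0, 1, 0, 3, 2, 3] else [0, 3, 2, 3, 1, 2, 0, 1],
    if β then [3, 0, 1, 2, 0, 3, 1, 2] else [2, 1, 3, 0, 1, 2, 3, 0]].getD i []).getD k 0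

/-- The difference matrices for `t = 6`, found by computer search. -/
def d6 (β : Bool) (k i : ℕ) : ℕ :=
  ([[], [0, 0, 1, 1, 2, 2, 3, 3, 4, 4, 5, 5],
    if β then [3, 5, 2, 3, 0, 1, 0, 4, 2, 4, 1, 5] else [0, 4, 0, 1, 3, 4, 2, 5, 1, 5, 2, 3],
    if β then [0, 4, 1, 3, 1, 5, 2, 4, 5, 0, 2, 3]
      else [5, 2, 0, 4, 4, 3, 3, 1, 1, 2, 0, 5]].getD i []).getD k 0

/-- For a prime `t ≥ 5`: two shifted copies of the linear difference matrix `i * b`. -/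
def dp (t : ℕ) (β : Bool) (k i : ℕ) : ℕ :=
  i * k + (i / 2) * (k / t + cond β 2 0)

/-- For `t = 22`: the product of linear matrices over `ℤ/11` with a Hadamard matrix over `ℤ/2`. -/
def d22 (β : Bool) (k i : ℕ) : ℕ :=
  12 * (i * k + (i / 2) * cond β 1 0) + 11 * ((i % 2) * (k / 11) + (i / 2) * (k / 22))

end DGDDConstruction

open DGDDConstruction in
theorem exists_superSimple_DGDD_type_t_pow_four (t : ℕ) (ht : t ∈ ({4, 5, 6, 13, 19, 22} : Finset ℕ)) :
    ∃ (groups : Finset (Finset (Fin (4 * t))))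
      (D : DGDD (Fin (4 * t)) groups 4 2),
      IsGroupPartition groups ∧ groups.card = 4 ∧
      (∀ G ∈ groups, G.card = t) ∧
      D.SuperSimple ∧ D.DefiningHalf := by
  simp only [Finset.mem_insert, Finset.mem_singleton] at ht
  rcases ht with rfl | rfl | rfl | rfl | rfl | rfl
  · exact main_check 4 d4 (by decide +kernel) (by decide +kernel) (by decide +kernel)
      (by decide +kernel)
  · exact main_check 5 (dp 5) (by decide +kernel) (by decide +kernel) (by decide +kernel)
      (by decide +kernel)
  · exact main_check 6 d6 (by decide +kernel) (by decide +kernel) (by decide +kernel)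
      (by decide +kernel)
  · exact main_check 13 (dp 13) (by decide +kernel) (by decide +kernel) (by decide +kernel)
      (by decide +kernel)
  · exact main_check 19 (dp 19) (by decide +kernel) (by decide +kernel) (by decide +kernel)
      (by decide +kernel)
  · exact main_check 22 d22 (by decide +kernel) (by decide +kernel) (by decide +kernel)
      (by decide +kernel)
end

section
/- For every t ∈ {4, 5} there exists a super-simple (4,2)-DGDD of type 9^t in which every defining set contains at least half of the blocks. -/
/-- Ordered six-tuples. The tuple `(x, y, u, v, w, z)` encodes the two blocks
`[x, y, u, v]` and `[y, x, w, z]`, which form a directed trade of volume two. -/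
abbrev Six (α : Type*) := α × α × α × α × α × α

/-- The two blocks encoded by a six-tuple. -/
def blk {α : Type*} (p : Six α) : List (List α) :=
  [[p.1, p.2.1, p.2.2.1, p.2.2.2.1], [p.2.1, p.1, p.2.2.2.2.1, p.2.2.2.2.2]]

/-- The two blocks of the trade mate. -/
def blk' {α : Type*} (p : Six α) : List (List α) :=
  [[p.2.1, p.1, p.2.2.1, p.2.2.2.1], [p.1, p.2.1, p.2.2.2.2.1, p.2.2.2.2.2]]

/-- Occurrence of an ordered pair in a list. -/
theorem pair_sublist_cons_s8 {α : Type*} (p q a : α) (l : List α) :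
    [p, q].Sublist (a :: l) ↔ (p = a ∧ q ∈ l) ∨ [p, q].Sublist l := by
  constructor
  · intro h
    cases h with
    | cons _ h => exact Or.inr h
    | cons_cons _ h => exact Or.inl ⟨rfl, List.singleton_sublist.1 h⟩
  · rintro (⟨rfl, h⟩ | h)
    · exact (List.singleton_sublist.2 h).cons_cons _
    · exact h.cons _

theorem ifs_balanced (E₁ E₂ Q₁ Q₂ : Prop) [Decidable (E₁ ∨ Q₁)] [Decidable (E₁ ∨ Q₂)]
    [Decidable (E₂ ∨ Q₁)] [Decidable (E₂ ∨ Q₂)] (h1 : E₁ → ¬ Q₁) (h2 : E₁ → ¬ Q₂)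
    (h3 : E₂ → ¬ Q₁) (h4 : E₂ → ¬ Q₂) (h : ¬ (E₁ ∧ E₂)) :
    ((0 + if E₁ ∨ Q₂ then 1 else 0) + if E₂ ∨ Q₁ then 1 else 0) =
      (0 + if E₂ ∨ Q₂ then 1 else 0) + if E₁ ∨ Q₁ then 1 else 0 := by
  by_cases e1 : E₁ <;> by_cases e2 : E₂ <;> by_cases q1 : Q₁ <;> by_cases q2 : Q₂ <;> simp_all

theorem trade_balanced {α : Type*} [DecidableEq α] (s : Six α)
    (hs : ∀ b ∈ blk s, b.Nodup) (p q : α) (hpq : p ≠ q) :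
    (blk' s).countP (fun b => decide ([p, q].Sublist b)) =
      (blk s).countP (fun b => decide ([p, q].Sublist b)) := by
  obtain ⟨x, y, u, v, w, z⟩ := s
  simp only [blk, List.mem_cons, List.not_mem_nil, or_false, forall_eq_or_imp,
    forall_eq] at hs
  obtain ⟨h1, h2⟩ := hs
  have key : ∀ (x y : α) (l : List α), [p, q].Sublist (x :: y :: l) ↔
      (p = x ∧ q = y) ∨ ((p = x ∨ p = y) ∧ q ∈ l ∨ [p, q].Sublist l) := by
    intro x y l
    rw [pair_sublist_cons_s8, pair_sublist_cons_s8, List.mem_cons]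
    tauto
  have key2 : ∀ (x y : α) (l : List α), (x :: y :: l).Nodup → (p = x ∧ q = y) →
      ¬ ((p = x ∨ p = y) ∧ q ∈ l ∨ [p, q].Sublist l) := by
    rintro x y l h ⟨rfl, rfl⟩ h'
    have hq : q ∈ l := by
      rcases h' with h' | h'
      · exact h'.2
      · exact h'.subset (by simp)
    simp only [List.nodup_cons] at h
    exact h.2.1 hq
  have h1' : ([y, x, u, v] : List α).Nodup := (List.Perm.swap x y [u, v]).nodup_iff.2 h1
  have h2' : ([x, y, w, z] : List α).Nodup := (List.Perm.swap y x [w, z]).nodup_iff.2 h2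
  have a1 := key2 _ _ _ h1
  have a2 := key2 _ _ _ h2
  have a3 := key2 _ _ _ h1'
  have a4 := key2 _ _ _ h2'
  simp only [blk, blk', List.countP_cons, List.countP_nil, decide_eq_true_eq, key x y, key y x]
  have c1 : ((p = y ∨ p = x) ∧ q ∈ [u, v] ∨ [p, q].Sublist [u, v]) ↔
    ((p = x ∨ p = y) ∧ q ∈ [u, v] ∨ [p, q].Sublist [u, v]) := by rw [or_comm (a := p = y)]
  have c2 : ((p = y ∨ p = x) ∧ q ∈ [w, z] ∨ [p, q].Sublist [w, z]) ↔
    ((p = x ∨ p = y) ∧ q ∈ [w, z] ∨ [p, q].Sublist [w, z]) := by rw [or_comm (a := p = y)]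
  simp only [c1, c2]
  rw [c1] at a3
  rw [c2] at a2
  refine ifs_balanced _ _ _ _ a1 a4 a3 a2 ?_
  rintro ⟨e1, e2⟩
  exact hpq (e2.1.trans e1.2.symm)

/-- Abstract form of the construction: a block list made of volume-two trades. -/
theorem core {X : Type*} [DecidableEq X] (groups : Finset (Finset X)) (P : List (Six X))
    (hnd : ∀ b ∈ P.flatMap blk, b.Nodup)
    (htr : ∀ b ∈ P.flatMap blk, ∀ G ∈ groups, (b.toFinset ∩ G).card ≤ 1)
    (hcov : ∀ x y : X, x ≠ y → (∀ G ∈ groups, ¬(x ∈ G ∧ y ∈ G)) →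
      (P.flatMap blk).countP (fun b => decide ([x, y].Sublist b)) = 2)
    (hB : (P.flatMap blk).Nodup)
    (hss : ∀ b ∈ P.flatMap blk, ∀ c ∈ P.flatMap blk, b ≠ c →
      (b.toFinset ∩ c.toFinset).card ≤ 2) :
    ∃ D : DGDD X groups 4 2, D.SuperSimple ∧ D.DefiningHalf := by
  have hlen : ∀ b ∈ P.flatMap blk, b.length = 4 := by
    intro b hb
    obtain ⟨p, -, hp⟩ := List.mem_flatMap.1 hb
    simp only [blk, List.mem_cons, List.not_mem_nil, or_false] at hp
    rcases hp with rfl | rfl <;> rfl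
  let D : DGDD X groups 4 2 :=
    { blocks := (P.flatMap blk : List (List X))
      len := fun b hb => hlen b hb
      nodup := fun b hb => hnd b hb
      transverse := fun b hb => htr b hb
      covers := fun x y h1 h2 => by
        rw [Multiset.coe_countP]; exact hcov x y h1 h2 }
  refine ⟨D, ⟨Multiset.coe_nodup.2 hB, fun b hb c hc => hss b hb c hc⟩, ?_⟩
  rintro S ⟨hS, huniq⟩
  have hSn : S.Nodup := Multiset.nodup_of_le hS (Multiset.coe_nodup.2 hB)
  have hmeet : ∀ p ∈ P, ∃ b, b ∈ blk p ∧ b ∈ S := by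
    intro p hp
    by_contra! hcon
    obtain ⟨l₁, l₂, rfl⟩ := List.append_of_mem hp
    have hmem : ∀ b, b ∈ (l₁ ++ p :: l₂).flatMap blk ↔
        b ∈ l₁.flatMap blk ∨ b ∈ blk p ∨ b ∈ l₂.flatMap blk := by
      intro b
      simp only [List.flatMap_append, List.flatMap_cons, List.mem_append]
    have hmem' : ∀ b, b ∈ l₁.flatMap blk ++ (blk' p ++ l₂.flatMap blk) ↔
        b ∈ l₁.flatMap blk ∨ b ∈ blk' p ∨ b ∈ l₂.flatMap blk := by
      intro b
      simp only [List.mem_append]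
    have hperm : ∀ b ∈ blk' p, ∃ c ∈ blk p, b.Perm c := by
      intro b hb
      simp only [blk', List.mem_cons, List.not_mem_nil, or_false] at hb
      rcases hb with rfl | rfl
      · exact ⟨_, List.mem_cons_self, List.Perm.swap _ _ _⟩
      · exact ⟨_, List.mem_cons_of_mem _ List.mem_cons_self, List.Perm.swap _ _ _⟩
    have hred : ∀ b ∈ l₁.flatMap blk ++ (blk' p ++ l₂.flatMap blk),
        ∃ c ∈ (l₁ ++ p :: l₂).flatMap blk, b.Perm c := by
      intro b hb
      rcases (hmem' b).1 hb with h | h | h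
      · exact ⟨b, (hmem b).2 (Or.inl h), List.Perm.refl _⟩
      · obtain ⟨c, hc, hbc⟩ := hperm b h
        exact ⟨c, (hmem c).2 (Or.inr (Or.inl hc)), hbc⟩
      · exact ⟨b, (hmem b).2 (Or.inr (Or.inr h)), List.Perm.refl _⟩
    let D' : DGDD X groups 4 2 :=
      { blocks := (l₁.flatMap blk ++ (blk' p ++ l₂.flatMap blk) : List (List X))
        len := fun b hb => by
          obtain ⟨c, hc, hbc⟩ := hred b hb
          rw [hbc.length_eq]; exact hlen c hc
        nodup := fun b hb => by
          obtain ⟨c, hc, hbc⟩ := hred b hb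
          rw [hbc.nodup_iff]; exact hnd c hc
        transverse := fun b hb => by
          obtain ⟨c, hc, hbc⟩ := hred b hb
          rw [List.toFinset_eq_of_perm _ _ hbc]; exact htr c hc
        covers := fun x y h1 h2 => by
          rw [Multiset.coe_countP, ← hcov x y h1 h2]
          simp only [List.flatMap_append, List.flatMap_cons, List.countP_append]
          have := trade_balanced p (fun b hb => hnd b ((hmem b).2 (Or.inr (Or.inl hb)))) x y h1
          rw [this] }
    have hle : S ≤ D'.blocks := by
      rw [Multiset.le_iff_subset hSn]
      intro b hb
      have hb' : b ∈ (l₁ ++ p :: l₂).flatMap blk := Multiset.mem_of_le hS hb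
      refine (hmem' b).2 ?_
      rcases (hmem b).1 hb' with h | h | h
      · exact Or.inl h
      · exact absurd hb (hcon b h)
      · exact Or.inr (Or.inr h)
    have heq := huniq D' hle
    have hf' : [p.2.1, p.1, p.2.2.1, p.2.2.2.1] ∈ D'.blocks :=
      (hmem' _).2 (Or.inr (Or.inl List.mem_cons_self))
    rw [heq] at hf'
    have hf : [p.1, p.2.1, p.2.2.1, p.2.2.2.1] ∈ (l₁ ++ p :: l₂).flatMap blk :=
      (hmem _).2 (Or.inr (Or.inl List.mem_cons_self))
    have hfn := hnd _ hf
    have hne : [p.1, p.2.1, p.2.2.1, p.2.2.2.1] ≠ [p.2.1, p.1, p.2.2.1, p.2.2.2.1] := by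
      intro h
      have h0 := (List.cons.inj h).1
      rw [h0] at hfn
      simp at hfn
    have h2 := hss _ hf _ hf' hne
    rw [List.toFinset_eq_of_perm _ _ (List.Perm.swap p.1 p.2.1 [p.2.2.1, p.2.2.2.1]),
      Finset.inter_self, List.toFinset_card_of_nodup hfn] at h2
    simp at h2
  have hcard : Multiset.card D.blocks = 2 * P.length := by
    change (P.flatMap blk).length = _
    rw [List.length_flatMap]
    simp [blk, mul_comm]
  rw [hcard]
  choose! c hc1 hc2 using hmeet
  have hmapnd : (P.map c).Nodup := by
    have h := (List.nodup_flatMap.1 hB).2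
    rw [List.Nodup, List.pairwise_map]
    refine List.Pairwise.imp_of_mem ?_ h
    intro a b ha hb hab heq
    exact hab (hc1 a ha) (heq ▸ hc1 b hb)
  have hle : ((P.map c : List (List X)) : Multiset (List X)) ≤ S := by
    rw [Multiset.le_iff_subset (Multiset.coe_nodup.2 hmapnd)]
    intro b hb
    obtain ⟨p, hp, rfl⟩ := List.mem_map.1 (Multiset.mem_coe.1 hb)
    exact hc2 p hp
  have := Multiset.card_le_card hle
  simp only [Multiset.coe_card, List.length_map] at this
  omega

/-! ### Computable checks on lists of natural numbers -/

/-- The elements of a list that come after the first occurrence of `x`, put in front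
of the list `r`. -/
noncomputable def succs (x : ℕ) (r b : List ℕ) : List ℕ :=
  List.rec r (fun a l ih => Bool.rec ih (List.rec r (fun c _ ih' => c :: ih') l) (Nat.beq a x)) b

/-- Boolean membership. -/
noncomputable def mem? (x : ℕ) (l : List ℕ) : Bool :=
  List.rec false (fun a _ ih => Bool.rec ih true (Nat.beq a x)) l

/-- Number of occurrences. -/
noncomputable def cnt (x : ℕ) (l : List ℕ) : ℕ :=
  List.rec 0 (fun a _ ih => Bool.rec ih (Nat.succ ih) (Nat.beq a x)) l

/-- Number of elements of the first list occurring in the second. -/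
noncomputable def interLen (b c : List ℕ) : ℕ :=
  List.rec 0 (fun a _ ih => Bool.rec ih (Nat.succ ih) (mem? a c)) b

/-- All elements of a list satisfy a Boolean predicate. -/
noncomputable def allB {α : Type} (f : α → Bool) (l : List α) : Bool :=
  List.rec true (fun a _ ih => Bool.rec false ih (f a)) l

/-- The blocks containing `x`. -/
noncomputable def thru (x : ℕ) (N : List (List ℕ)) : List (List ℕ) :=
  List.rec [] (fun b _ ih => Bool.rec ih (b :: ih) (mem? x b)) N

/-- Concatenation of the successor lists. -/
noncomputable def allSuccs (x : ℕ) (N : List (List ℕ)) : List ℕ :=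
  List.rec [] (fun b _ ih => succs x ih b) N

/-- Pairwise check that two blocks have at most two common elements. -/
noncomputable def pairOK (N : List (List ℕ)) : Bool :=
  List.rec true (fun b l ih =>
    Bool.rec false ih (allB (fun c => Nat.ble (interLen b c) 2) l)) N

/-- No repetitions. -/
noncomputable def nodupOK (l : List ℕ) : Bool :=
  List.rec true (fun a l ih => Bool.rec ih false (mem? a l)) l

/-- Blocks meet every residue class at most once. -/
noncomputable def checkTrans (t : ℕ) (N : List (List ℕ)) : Bool :=
  allB (fun b => nodupOK (b.map (fun a => a % t))) N

/-- Boolean check below a bound. -/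
noncomputable def belowB (f : ℕ → Bool) (n : ℕ) : Bool :=
  Nat.rec true (fun k ih => Bool.rec false ih (f k)) n

/-- Every ordered pair of points in different residue classes is covered twice. -/
noncomputable def checkCov (t n : ℕ) (N : List (List ℕ)) : Bool :=
  belowB (fun x => (fun s => belowB (fun y =>
    Bool.rec (Nat.beq (cnt y s) 2) true (Nat.beq (x % t) (y % t))) n) (allSuccs x N)) n

/-- Any two blocks through a given pair of points share no third point. -/
noncomputable def checkSimple (n : ℕ) (N : List (List ℕ)) : Bool :=
  belowB (fun x => (fun M => belowB (fun y => pairOK (thru y M)) x) (thru x N)) n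

theorem recB_eq {α : Type*} (b : Bool) (p q : α) :
    (Bool.rec q p b : α) = if b = true then p else q := by
  cases b <;> rfl

theorem recBeq_eq {α : Type*} (a x : ℕ) (p q : α) :
    (Bool.rec q p (Nat.beq a x) : α) = if a = x then p else q := by
  rw [recB_eq]
  by_cases h : a = x
  · rw [if_pos h, if_pos (Nat.beq_eq.symm ▸ h)]
  · rw [if_neg h, if_neg (Nat.beq_eq.symm ▸ h)]

theorem mem?_iff (x : ℕ) (l : List ℕ) : mem? x l = true ↔ x ∈ l := by
  induction l with
  | nil => simp [mem?]
  | cons a l ih =>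
    have e : mem? x (a :: l) = if a = x then true else mem? x l := recBeq_eq _ _ _ _
    rw [e, List.mem_cons]
    by_cases h : a = x
    · simp [h]
    · simp [h, ih, Ne.symm h]

theorem cnt_eq (x : ℕ) (l : List ℕ) : cnt x l = l.count x := by
  induction l with
  | nil => simp [cnt]
  | cons a l ih =>
    have e : cnt x (a :: l) = if a = x then Nat.succ (cnt x l) else cnt x l :=
      recBeq_eq _ _ _ _
    rw [e, List.count_cons]
    by_cases h : a = x
    · simp [h, ih]
    · simp [h, ih]

theorem interLen_filter (b c : List ℕ) :
    interLen b c = (b.filter (fun a => mem? a c)).length := by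
  induction b with
  | nil => rfl
  | cons a b ih =>
    have e : interLen (a :: b) c =
      if mem? a c = true then Nat.succ (interLen b c) else interLen b c := recB_eq _ _ _
    rw [e, List.filter_cons, ih]
    split_ifs <;> simp

theorem allB_iff {α : Type} (f : α → Bool) (l : List α) :
    allB f l = true ↔ ∀ a ∈ l, f a = true := by
  induction l with
  | nil => simp [allB]
  | cons a l ih =>
    have e : allB f (a :: l) = if f a = true then allB f l else false := recB_eq _ _ _
    rw [e, List.forall_mem_cons, ← ih]
    by_cases h : f a = true
    · simp [h]
    · simp [h]

theorem belowB_iff (f : ℕ → Bool) (n : ℕ) : belowB f n = true ↔ ∀ k < n, f k = true := by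
  induction n with
  | zero => simp [belowB]
  | succ n ih =>
    have e : belowB f (n + 1) = if f n = true then belowB f n else false := recB_eq _ _ _
    rw [e, Nat.forall_lt_succ_right, ← ih]
    by_cases h : f n = true
    · simp [h]
    · simp [h]

theorem thru_eq (x : ℕ) (N : List (List ℕ)) : thru x N = N.filter (mem? x) := by
  induction N with
  | nil => rfl
  | cons b N ih =>
    have e : thru x (b :: N) = if mem? x b = true then b :: thru x N else thru x N :=
      recB_eq _ _ _
    rw [e, List.filter_cons, ih]

theorem nodupOK_iff (l : List ℕ) : nodupOK l = true ↔ l.Nodup := by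
  induction l with
  | nil => simp [nodupOK]
  | cons a l ih =>
    have e : nodupOK (a :: l) = if mem? a l = true then false else nodupOK l := recB_eq _ _ _
    rw [e, List.nodup_cons, ← ih, ← mem?_iff]
    by_cases h : mem? a l = true
    · simp [h]
    · simp [h]

theorem pairOK_iff (l : List (List ℕ)) :
    pairOK l = true ↔ l.Pairwise (fun b c => interLen b c ≤ 2) := by
  induction l with
  | nil => simp [pairOK]
  | cons a l ih =>
    have e : pairOK (a :: l) =
      if allB (fun c => Nat.ble (interLen a c) 2) l = true then pairOK l else false :=
        recB_eq _ _ _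
    have e' := allB_iff (fun c => Nat.ble (interLen a c) 2) l
    simp only [Nat.ble_eq] at e'
    rw [e, List.pairwise_cons, ← ih, ← e']
    split_ifs with h
    · exact ⟨fun h' => ⟨h, h'⟩, fun h' => h'.2⟩
    · exact ⟨fun h' => absurd h' (by simp), fun h' => absurd h'.1 h⟩

theorem count_succs (x y : ℕ) (r b : List ℕ) (hb : b.Nodup) :
    (succs x r b).count y = (if [x, y].Sublist b then 1 else 0) + r.count y := by
  induction b with
  | nil => simp [succs]
  | cons a l ih =>
    rw [List.nodup_cons] at hb
    have e0 : ∀ m : List ℕ, (List.rec r (fun c _ ih' => c :: ih') m : List ℕ) = m ++ r := by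
      intro m
      induction m with
      | nil => rfl
      | cons c m ihm => rw [List.cons_append, ← ihm]
    have e : succs x r (a :: l) = if a = x then
        (List.rec r (fun c _ ih' => c :: ih') l : List ℕ) else succs x r l := recBeq_eq _ _ _ _
    rw [e, e0]
    simp only [pair_sublist_cons_s8]
    by_cases h : a = x
    · subst h
      rw [if_pos rfl, List.count_append, List.Nodup.count hb.2]
      have : ¬ [a, y].Sublist l := fun h => hb.1 (h.subset (by simp))
      simp [this]
    · rw [if_neg h, ih hb.2]
      simp [Ne.symm h]

theorem count_allSuccs (x y : ℕ) (N : List (List ℕ)) (hN : ∀ b ∈ N, b.Nodup) :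
    (allSuccs x N).count y = N.countP (fun b => decide ([x, y].Sublist b)) := by
  induction N with
  | nil => simp [allSuccs]
  | cons b N ih =>
    have e : allSuccs x (b :: N) = succs x (allSuccs x N) b := rfl
    rw [e, count_succs x y _ b (hN b List.mem_cons_self),
      ih (fun c hc => hN c (List.mem_cons_of_mem _ hc)), List.countP_cons]
    simp [add_comm]

theorem interLen_eq {n : ℕ} (b c : List (Fin n)) :
    interLen (b.map Fin.val) (c.map Fin.val) = (b.filter (fun a => decide (a ∈ c))).length := by
  rw [interLen_filter, List.filter_map, List.length_map]
  congr 1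
  apply List.filter_congr
  intro a _
  rw [Bool.eq_iff_iff]
  simp only [Function.comp, mem?_iff, decide_eq_true_eq]
  exact List.mem_map_of_injective Fin.val_injective

theorem pairwise_of_local (n : ℕ) (N : List (List ℕ)) (hn : ∀ b ∈ N, ∀ a ∈ b, a < n)
    (hnd : ∀ b ∈ N, b.Nodup)
    (h : ∀ x < n, ∀ y < x,
      ((N.filter (mem? x)).filter (mem? y)).Pairwise (fun b c => interLen b c ≤ 2)) :
    N.Pairwise (fun b c => interLen b c ≤ 2) := by
  induction N with
  | nil => exact List.Pairwise.nil
  | cons b N ih =>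
    rw [List.pairwise_cons]
    constructor
    · intro c hc
      by_contra! hlt
      have hbn := hnd b List.mem_cons_self
      have hbf : (b.filter (fun a => mem? a c)).Nodup := hbn.filter _
      have hcard : 1 < (b.filter (fun a => mem? a c)).toFinset.card := by
        rw [List.toFinset_card_of_nodup hbf]
        rw [interLen_filter] at hlt
        omega
      obtain ⟨x, hx, y, hy, hxy⟩ : ∃ x ∈ (b.filter (fun a => mem? a c)).toFinset,
          ∃ y ∈ (b.filter (fun a => mem? a c)).toFinset, y < x := by
        obtain ⟨x, hx, y, hy, hxy⟩ := Finset.one_lt_card.1 hcard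
        rcases lt_or_gt_of_ne hxy with h' | h'
        · exact ⟨y, hy, x, hx, h'⟩
        · exact ⟨x, hx, y, hy, h'⟩
      rw [List.mem_toFinset, List.mem_filter] at hx hy
      have hl := h x (hn b List.mem_cons_self x hx.1) y hxy
      have e1 : mem? x b = true := (mem?_iff x b).2 hx.1
      have e2 : mem? y b = true := (mem?_iff y b).2 hy.1
      rw [List.filter_cons_of_pos e1, List.filter_cons_of_pos e2, List.pairwise_cons] at hl
      have := hl.1 c (List.mem_filter.2 ⟨List.mem_filter.2 ⟨hc, hx.2⟩, hy.2⟩)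
      omega
    · refine ih (fun c hc => hn c (List.mem_cons_of_mem _ hc))
        (fun c hc => hnd c (List.mem_cons_of_mem _ hc)) ?_
      intro x hx y hxy
      refine (h x hx y hxy).sublist ?_
      exact ((List.sublist_cons_self b N).filter _).filter _

/-- The groups: residue classes modulo `t`. -/
def resGroups (t : ℕ) : Finset (Finset (Fin (9 * t))) :=
  Finset.univ.image (fun i : Fin t => Finset.univ.filter (fun x : Fin (9 * t) => x.val % t = i.val))

theorem resGroups_partition (t : ℕ) (ht : 0 < t) : IsGroupPartition (resGroups t) := by
  intro x
  refine ⟨Finset.univ.filter (fun y : Fin (9 * t) => y.val % t = x.val % t), ⟨?_, by simp⟩, ?_⟩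
  · exact Finset.mem_image.2 ⟨⟨x.val % t, Nat.mod_lt _ ht⟩, Finset.mem_univ _, rfl⟩
  · rintro G ⟨hG, hx⟩
    obtain ⟨i, -, rfl⟩ := Finset.mem_image.1 hG
    rw [Finset.mem_filter] at hx
    rw [hx.2]

theorem fromCheck (t : ℕ) (ht : 0 < t) (P : List (Six (Fin (9 * t)))) (N : List (List ℕ))
    (hN : (P.flatMap blk).map (fun b => b.map Fin.val) = N)
    (h1 : checkTrans t N = true) (h2 : checkCov t (9 * t) N = true)
    (h3 : checkSimple (9 * t) N = true) :
    ∃ D : DGDD (Fin (9 * t)) (resGroups t) 4 2, D.SuperSimple ∧ D.DefiningHalf := by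
  have hmodnd : ∀ b ∈ N, (b.map (fun a => a % t)).Nodup := by
    intro b hb
    rw [checkTrans, allB_iff] at h1
    exact (nodupOK_iff _).1 (h1 b hb)
  have hNnd : ∀ b ∈ N, b.Nodup := fun b hb => List.Nodup.of_map _ (hmodnd b hb)
  have hval : ∀ b ∈ P.flatMap blk, b.map Fin.val ∈ N := by
    intro b hb
    rw [← hN]
    exact List.mem_map_of_mem hb
  have hnd : ∀ b ∈ P.flatMap blk, b.Nodup := fun b hb => List.Nodup.of_map _ (hNnd _ (hval b hb))
  have hlt : ∀ b ∈ N, ∀ a ∈ b, a < 9 * t := by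
    intro b hb a ha
    rw [← hN] at hb
    obtain ⟨c, -, rfl⟩ := List.mem_map.1 hb
    obtain ⟨d, -, rfl⟩ := List.mem_map.1 ha
    exact d.isLt
  have hpw : N.Pairwise (fun b c => interLen b c ≤ 2) := by
    refine pairwise_of_local (9 * t) N hlt hNnd ?_
    intro x hx y hxy
    rw [checkSimple, belowB_iff] at h3
    have h3x := h3 x hx
    rw [belowB_iff] at h3x
    have h3y := (pairOK_iff _).1 (h3x y hxy)
    rwa [thru_eq, thru_eq] at h3y
  have hpw' : (P.flatMap blk).Pairwise
      (fun b c => (b.filter (fun a => decide (a ∈ c))).length ≤ 2) := by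
    rw [← hN, List.pairwise_map] at hpw
    refine hpw.imp ?_
    intro b c h
    rwa [interLen_eq] at h
  have hpw2 : (P.flatMap blk).Pairwise (fun b c => (b.toFinset ∩ c.toFinset).card ≤ 2) := by
    refine hpw'.imp ?_
    intro b c h
    refine le_trans ?_ h
    refine le_trans (Finset.card_le_card ?_) (List.toFinset_card_le _)
    intro a ha
    simpa using ha
  refine core (resGroups t) P hnd ?_ ?_ ?_ ?_
  · intro b hb G hG
    obtain ⟨i, -, rfl⟩ := Finset.mem_image.1 hG
    rw [Finset.card_le_one]
    intro a ha c hc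
    simp only [Finset.mem_inter, List.mem_toFinset, Finset.mem_filter, Finset.mem_univ,
      true_and] at ha hc
    have hm := hmodnd _ (hval b hb)
    rw [List.map_map] at hm
    exact List.inj_on_of_nodup_map hm ha.1 hc.1 (ha.2.trans hc.2.symm)
  · intro x y hxy hG
    have hmod : x.val % t ≠ y.val % t := by
      intro h
      refine hG (Finset.univ.filter (fun z : Fin (9 * t) => z.val % t = x.val % t)) ?_ ?_
      · exact Finset.mem_image.2 ⟨⟨x.val % t, Nat.mod_lt _ ht⟩, Finset.mem_univ _, rfl⟩
      · simp [h]
    rw [checkCov, belowB_iff] at h2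
    have h2x := h2 x.val x.isLt
    rw [belowB_iff] at h2x
    have h2y := h2x y.val y.isLt
    rw [recBeq_eq, if_neg hmod, Nat.beq_eq, cnt_eq, count_allSuccs _ _ _ hNnd,
      ← hN, List.countP_map] at h2y
    rw [← h2y]
    apply List.countP_congr
    intro b _
    simp only [Function.comp, decide_eq_true_eq]
    constructor
    · intro h; exact h.map Fin.val
    · intro h
      obtain ⟨l, hl, he⟩ := List.sublist_map_iff.1 h
      have : l = [x, y] := by
        apply List.map_injective_iff.2 Fin.val_injective
        exact he.symm
      exact this ▸ hl
  · refine hpw2.imp_of_mem ?_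
    rintro b c hb hc h rfl
    rw [Finset.inter_self, List.toFinset_card_of_nodup (hnd b hb)] at h
    obtain ⟨p, -, hp⟩ := List.mem_flatMap.1 hb
    simp only [blk, List.mem_cons, List.not_mem_nil, or_false] at hp
    rcases hp with rfl | rfl <;> simp at h
  · intro b hb c hc hbc
    have : Std.Symm (fun b c : List (Fin (9 * t)) => (b.toFinset ∩ c.toFinset).card ≤ 2) :=
      ⟨fun b c h => by rwa [Finset.inter_comm]⟩
    exact List.Pairwise.forall hpw2 hb hc hbc

/-- All entries of a six-tuple are below `n`. -/
def sixLt (n : ℕ) (p : Six ℕ) : Bool :=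
  Nat.blt p.1 n && Nat.blt p.2.1 n && Nat.blt p.2.2.1 n && Nat.blt p.2.2.2.1 n &&
    Nat.blt p.2.2.2.2.1 n && Nat.blt p.2.2.2.2.2 n

/-- Reduce a six-tuple of naturals modulo `n`. -/
def toFin (n : ℕ) [NeZero n] (p : Six ℕ) : Six (Fin n) :=
  (Fin.ofNat n p.1, Fin.ofNat n p.2.1, Fin.ofNat n p.2.2.1, Fin.ofNat n p.2.2.2.1,
    Fin.ofNat n p.2.2.2.2.1, Fin.ofNat n p.2.2.2.2.2)

theorem toFin_roundtrip (n : ℕ) [NeZero n] (L : List (Six ℕ)) (h : L.all (sixLt n) = true) :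
    ((L.map (toFin n)).flatMap blk).map (fun b => b.map Fin.val) = L.flatMap blk := by
  induction L with
  | nil => rfl
  | cons p L ih =>
    rw [List.all_cons, Bool.and_eq_true] at h
    rw [List.map_cons, List.flatMap_cons, List.map_append, ih h.2, List.flatMap_cons]
    congr 1
    have hp := h.1
    simp only [sixLt, Bool.and_eq_true, Nat.blt_eq] at hp
    obtain ⟨⟨⟨⟨⟨h1, h2⟩, h3⟩, h4⟩, h5⟩, h6⟩ := hp
    simp [blk, toFin, Nat.mod_eq_of_lt, h1, h2, h3, h4, h5, h6]

theorem resGroups_card (t : ℕ) : (resGroups t).card = t := by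
  rw [resGroups, Finset.card_image_of_injective, Finset.card_univ, Fintype.card_fin]
  intro i j hij
  have hi : (⟨i.val, by have := i.isLt; omega⟩ : Fin (9 * t)) ∈
      Finset.univ.filter (fun x : Fin (9 * t) => x.val % t = i.val) := by
    simp [Nat.mod_eq_of_lt i.isLt]
  have hij' : Finset.univ.filter (fun x : Fin (9 * t) => x.val % t = i.val) =
    Finset.univ.filter (fun x : Fin (9 * t) => x.val % t = j.val) := hij
  rw [hij', Finset.mem_filter] at hi
  have := hi.2
  simp only [Nat.mod_eq_of_lt i.isLt] at this
  exact Fin.ext this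

/-- Trade pairs, found by computer search. -/
def data4 : List (ℕ × ℕ × ℕ × ℕ × ℕ × ℕ) := [
  (0, 1, 2, 3, 23, 34), (0, 5, 6, 15, 35, 26), (0, 9, 10, 27, 11, 30), (0, 13, 14, 11, 19, 10),
  (0, 17, 18, 23, 31, 2), (0, 21, 22, 35, 7, 6), (0, 25, 26, 7, 15, 22), (0, 29, 30, 19, 27, 14),
  (0, 33, 34, 31, 3, 18), (4, 1, 6, 7, 15, 26), (4, 5, 10, 19, 27, 30), (4, 9, 2, 31, 3, 34),
  (4, 13, 18, 3, 23, 2), (4, 17, 22, 15, 35, 6), (4, 21, 14, 27, 11, 10), (4, 25, 30, 11, 19, 14),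
  (4, 29, 34, 23, 31, 18), (4, 33, 26, 35, 7, 22), (8, 1, 10, 11, 19, 30), (8, 5, 2, 23, 31, 34),
  (8, 9, 6, 35, 7, 26), (8, 13, 22, 7, 15, 6), (8, 17, 14, 19, 27, 10), (8, 21, 18, 31, 3, 2),
  (8, 25, 34, 3, 23, 18), (8, 29, 26, 15, 35, 22), (8, 33, 30, 27, 11, 14), (12, 1, 14, 15, 35, 10),
  (12, 5, 18, 27, 11, 2), (12, 9, 22, 3, 23, 6), (12, 13, 26, 23, 31, 22), (12, 17, 30, 35, 7, 14),
  (12, 21, 34, 11, 19, 18), (12, 25, 2, 19, 27, 34), (12, 29, 6, 31, 3, 26), (12, 33, 10, 7, 15, 30),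
  (16, 1, 18, 19, 27, 2), (16, 5, 22, 31, 3, 6), (16, 9, 14, 7, 15, 10), (16, 13, 30, 15, 35, 14),
  (16, 17, 34, 27, 11, 18), (16, 21, 26, 3, 23, 22), (16, 25, 6, 23, 31, 26), (16, 29, 10, 35, 7, 30),
  (16, 33, 2, 11, 19, 34), (20, 1, 22, 23, 31, 6), (20, 5, 14, 35, 7, 10), (20, 9, 18, 11, 19, 2),
  (20, 13, 34, 19, 27, 18), (20, 17, 26, 31, 3, 22), (20, 21, 30, 7, 15, 14), (20, 25, 10, 15, 35, 30),
  (20, 29, 2, 27, 11, 34), (20, 33, 6, 3, 23, 26), (24, 1, 26, 27, 11, 22), (24, 5, 30, 3, 23, 14),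
  (24, 9, 34, 15, 35, 18), (24, 13, 2, 35, 7, 34), (24, 17, 6, 11, 19, 26), (24, 21, 10, 23, 31, 30),
  (24, 25, 14, 31, 3, 10), (24, 29, 18, 7, 15, 2), (24, 33, 22, 19, 27, 6), (28, 1, 30, 31, 3, 14),
  (28, 5, 34, 7, 15, 18), (28, 9, 26, 19, 27, 22), (28, 13, 6, 27, 11, 26), (28, 17, 10, 3, 23, 30),
  (28, 21, 2, 15, 35, 34), (28, 25, 18, 35, 7, 2), (28, 29, 22, 11, 19, 6), (28, 33, 14, 23, 31, 10),
  (32, 1, 34, 35, 7, 18), (32, 5, 26, 11, 19, 22), (32, 9, 30, 23, 31, 14), (32, 13, 10, 31, 3, 30),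
  (32, 17, 2, 7, 15, 34), (32, 21, 6, 19, 27, 26), (32, 25, 22, 27, 11, 6), (32, 29, 14, 3, 23, 10),
  (32, 33, 18, 15, 35, 2), (22, 31, 0, 1, 17, 24), (14, 7, 0, 5, 21, 24), (18, 19, 0, 9, 13, 24),
  (34, 27, 0, 13, 29, 24), (26, 3, 0, 17, 33, 24), (30, 15, 0, 21, 25, 24), (10, 35, 0, 25, 5, 24),
  (2, 11, 0, 29, 9, 24), (6, 23, 0, 33, 1, 24), (14, 35, 4, 1, 17, 28), (18, 11, 4, 5, 21, 28),
  (22, 23, 4, 9, 13, 28), (26, 31, 4, 13, 29, 28), (30, 7, 4, 17, 33, 28), (34, 19, 4, 21, 25, 28),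
  (2, 27, 4, 25, 5, 28), (6, 3, 4, 29, 9, 28), (10, 15, 4, 33, 1, 28), (18, 27, 8, 1, 17, 32),
  (22, 3, 8, 5, 21, 32), (14, 15, 8, 9, 13, 32), (30, 35, 8, 13, 29, 32), (34, 11, 8, 17, 33, 32),
  (26, 23, 8, 21, 25, 32), (6, 31, 8, 25, 5, 32), (10, 7, 8, 29, 9, 32), (2, 19, 8, 33, 1, 32),
  (34, 7, 12, 1, 17, 0), (26, 19, 12, 5, 21, 0), (30, 31, 12, 9, 13, 0), (10, 3, 12, 13, 29, 0),
  (2, 15, 12, 17, 33, 0), (6, 27, 12, 21, 25, 0), (22, 11, 12, 25, 5, 0), (14, 23, 12, 29, 9, 0),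
  (18, 35, 12, 33, 1, 0), (26, 11, 16, 1, 17, 4), (30, 23, 16, 5, 21, 4), (34, 35, 16, 9, 13, 4),
  (2, 7, 16, 13, 29, 4), (6, 19, 16, 17, 33, 4), (10, 31, 16, 21, 25, 4), (14, 3, 16, 25, 5, 4),
  (18, 15, 16, 29, 9, 4), (22, 27, 16, 33, 1, 4), (30, 3, 20, 1, 17, 8), (34, 15, 20, 5, 21, 8),
  (26, 27, 20, 9, 13, 8), (6, 11, 20, 13, 29, 8), (10, 23, 20, 17, 33, 8), (2, 35, 20, 21, 25, 8),
  (18, 7, 20, 25, 5, 8), (22, 19, 20, 29, 9, 8), (14, 31, 20, 33, 1, 8), (10, 19, 24, 1, 17, 12),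
  (2, 31, 24, 5, 21, 12), (6, 7, 24, 9, 13, 12), (22, 15, 24, 13, 29, 12), (14, 27, 24, 17, 33, 12),
  (18, 3, 24, 21, 25, 12), (34, 23, 24, 25, 5, 12), (26, 35, 24, 29, 9, 12), (30, 11, 24, 33, 1, 12),
  (2, 23, 28, 1, 17, 16), (6, 35, 28, 5, 21, 16), (10, 11, 28, 9, 13, 16), (14, 19, 28, 13, 29, 16),
  (18, 31, 28, 17, 33, 16), (22, 7, 28, 21, 25, 16), (26, 15, 28, 25, 5, 16), (30, 27, 28, 29, 9, 16),
  (34, 3, 28, 33, 1, 16), (6, 15, 32, 1, 17, 20), (10, 27, 32, 5, 21, 20), (2, 3, 32, 9, 13, 20),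
  (18, 23, 32, 13, 29, 20), (22, 35, 32, 17, 33, 20), (14, 11, 32, 21, 25, 20), (30, 19, 32, 25, 5, 20),
  (34, 31, 32, 29, 9, 20), (26, 7, 32, 33, 1, 20)]

/-- Trade pairs, found by computer search. -/
def data5 : List (ℕ × ℕ × ℕ × ℕ × ℕ × ℕ) := [
  (0, 17, 26, 39, 36, 23), (1, 18, 27, 40, 37, 24), (2, 19, 28, 41, 38, 25), (3, 20, 29, 42, 39, 26),
  (4, 21, 30, 43, 40, 27), (5, 22, 31, 44, 41, 28), (6, 23, 32, 0, 42, 29), (7, 24, 33, 1, 43, 30),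
  (8, 25, 34, 2, 44, 31), (9, 26, 35, 3, 0, 32), (10, 27, 36, 4, 1, 33), (11, 28, 37, 5, 2, 34),
  (12, 29, 38, 6, 3, 35), (13, 30, 39, 7, 4, 36), (14, 31, 40, 8, 5, 37), (15, 32, 41, 9, 6, 38),
  (16, 33, 42, 10, 7, 39), (17, 34, 43, 11, 8, 40), (18, 35, 44, 12, 9, 41), (19, 36, 0, 13, 10, 42),
  (20, 37, 1, 14, 11, 43), (21, 38, 2, 15, 12, 44), (22, 39, 3, 16, 13, 0), (23, 40, 4, 17, 14, 1),
  (24, 41, 5, 18, 15, 2), (25, 42, 6, 19, 16, 3), (26, 43, 7, 20, 17, 4), (27, 44, 8, 21, 18, 5),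
  (28, 0, 9, 22, 19, 6), (29, 1, 10, 23, 20, 7), (30, 2, 11, 24, 21, 8), (31, 3, 12, 25, 22, 9),
  (32, 4, 13, 26, 23, 10), (33, 5, 14, 27, 24, 11), (34, 6, 15, 28, 25, 12), (35, 7, 16, 29, 26, 13),
  (36, 8, 17, 30, 27, 14), (37, 9, 18, 31, 28, 15), (38, 10, 19, 32, 29, 16), (39, 11, 20, 33, 30, 17),
  (40, 12, 21, 34, 31, 18), (41, 13, 22, 35, 32, 19), (42, 14, 23, 36, 33, 20), (43, 15, 24, 37, 34, 21),
  (44, 16, 25, 38, 35, 22), (0, 16, 37, 39, 24, 22), (1, 17, 38, 40, 25, 23), (2, 18, 39, 41, 26, 24),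
  (3, 19, 40, 42, 27, 25), (4, 20, 41, 43, 28, 26), (5, 21, 42, 44, 29, 27), (6, 22, 43, 0, 30, 28),
  (7, 23, 44, 1, 31, 29), (8, 24, 0, 2, 32, 30), (9, 25, 1, 3, 33, 31), (10, 26, 2, 4, 34, 32),
  (11, 27, 3, 5, 35, 33), (12, 28, 4, 6, 36, 34), (13, 29, 5, 7, 37, 35), (14, 30, 6, 8, 38, 36),
  (15, 31, 7, 9, 39, 37), (16, 32, 8, 10, 40, 38), (17, 33, 9, 11, 41, 39), (18, 34, 10, 12, 42, 40),
  (19, 35, 11, 13, 43, 41), (20, 36, 12, 14, 44, 42), (21, 37, 13, 15, 0, 43), (22, 38, 14, 16, 1, 44),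
  (23, 39, 15, 17, 2, 0), (24, 40, 16, 18, 3, 1), (25, 41, 17, 19, 4, 2), (26, 42, 18, 20, 5, 3),
  (27, 43, 19, 21, 6, 4), (28, 44, 20, 22, 7, 5), (29, 0, 21, 23, 8, 6), (30, 1, 22, 24, 9, 7),
  (31, 2, 23, 25, 10, 8), (32, 3, 24, 26, 11, 9), (33, 4, 25, 27, 12, 10), (34, 5, 26, 28, 13, 11),
  (35, 6, 27, 29, 14, 12), (36, 7, 28, 30, 15, 13), (37, 8, 29, 31, 16, 14), (38, 9, 30, 32, 17, 15),
  (39, 10, 31, 33, 18, 16), (40, 11, 32, 34, 19, 17), (41, 12, 33, 35, 20, 18), (42, 13, 34, 36, 21, 19),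
  (43, 14, 35, 37, 22, 20), (44, 15, 36, 38, 23, 21), (0, 24, 28, 31, 41, 38), (1, 25, 29, 32, 42, 39),
  (2, 26, 30, 33, 43, 40), (3, 27, 31, 34, 44, 41), (4, 28, 32, 35, 0, 42), (5, 29, 33, 36, 1, 43),
  (6, 30, 34, 37, 2, 44), (7, 31, 35, 38, 3, 0), (8, 32, 36, 39, 4, 1), (9, 33, 37, 40, 5, 2),
  (10, 34, 38, 41, 6, 3), (11, 35, 39, 42, 7, 4), (12, 36, 40, 43, 8, 5), (13, 37, 41, 44, 9, 6),
  (14, 38, 42, 0, 10, 7), (15, 39, 43, 1, 11, 8), (16, 40, 44, 2, 12, 9), (17, 41, 0, 3, 13, 10),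
  (18, 42, 1, 4, 14, 11), (19, 43, 2, 5, 15, 12), (20, 44, 3, 6, 16, 13), (21, 0, 4, 7, 17, 14),
  (22, 1, 5, 8, 18, 15), (23, 2, 6, 9, 19, 16), (24, 3, 7, 10, 20, 17), (25, 4, 8, 11, 21, 18),
  (26, 5, 9, 12, 22, 19), (27, 6, 10, 13, 23, 20), (28, 7, 11, 14, 24, 21), (29, 8, 12, 15, 25, 22),
  (30, 9, 13, 16, 26, 23), (31, 10, 14, 17, 27, 24), (32, 11, 15, 18, 28, 25), (33, 12, 16, 19, 29, 26),
  (34, 13, 17, 20, 30, 27), (35, 14, 18, 21, 31, 28), (36, 15, 19, 22, 32, 29), (37, 16, 20, 23, 33, 30),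
  (38, 17, 21, 24, 34, 31), (39, 18, 22, 25, 35, 32), (40, 19, 23, 26, 36, 33), (41, 20, 24, 27, 37, 34),
  (42, 21, 25, 28, 38, 35), (43, 22, 26, 29, 39, 36), (44, 23, 27, 30, 40, 37), (0, 18, 32, 44, 31, 19),
  (1, 19, 33, 0, 32, 20), (2, 20, 34, 1, 33, 21), (3, 21, 35, 2, 34, 22), (4, 22, 36, 3, 35, 23),
  (5, 23, 37, 4, 36, 24), (6, 24, 38, 5, 37, 25), (7, 25, 39, 6, 38, 26), (8, 26, 40, 7, 39, 27),
  (9, 27, 41, 8, 40, 28), (10, 28, 42, 9, 41, 29), (11, 29, 43, 10, 42, 30), (12, 30, 44, 11, 43, 31),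
  (13, 31, 0, 12, 44, 32), (14, 32, 1, 13, 0, 33), (15, 33, 2, 14, 1, 34), (16, 34, 3, 15, 2, 35),
  (17, 35, 4, 16, 3, 36), (18, 36, 5, 17, 4, 37), (19, 37, 6, 18, 5, 38), (20, 38, 7, 19, 6, 39),
  (21, 39, 8, 20, 7, 40), (22, 40, 9, 21, 8, 41), (23, 41, 10, 22, 9, 42), (24, 42, 11, 23, 10, 43),
  (25, 43, 12, 24, 11, 44), (26, 44, 13, 25, 12, 0), (27, 0, 14, 26, 13, 1), (28, 1, 15, 27, 14, 2),
  (29, 2, 16, 28, 15, 3), (30, 3, 17, 29, 16, 4), (31, 4, 18, 30, 17, 5), (32, 5, 19, 31, 18, 6),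
  (33, 6, 20, 32, 19, 7), (34, 7, 21, 33, 20, 8), (35, 8, 22, 34, 21, 9), (36, 9, 23, 35, 22, 10),
  (37, 10, 24, 36, 23, 11), (38, 11, 25, 37, 24, 12), (39, 12, 26, 38, 25, 13), (40, 13, 27, 39, 26, 14),
  (41, 14, 28, 40, 27, 15), (42, 15, 29, 41, 28, 16), (43, 16, 30, 42, 29, 17), (44, 17, 31, 43, 30, 18),
  (0, 7, 34, 36, 18, 16), (1, 8, 35, 37, 19, 17), (2, 9, 36, 38, 20, 18), (3, 10, 37, 39, 21, 19),
  (4, 11, 38, 40, 22, 20), (5, 12, 39, 41, 23, 21), (6, 13, 40, 42, 24, 22), (7, 14, 41, 43, 25, 23),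
  (8, 15, 42, 44, 26, 24), (9, 16, 43, 0, 27, 25), (10, 17, 44, 1, 28, 26), (11, 18, 0, 2, 29, 27),
  (12, 19, 1, 3, 30, 28), (13, 20, 2, 4, 31, 29), (14, 21, 3, 5, 32, 30), (15, 22, 4, 6, 33, 31),
  (16, 23, 5, 7, 34, 32), (17, 24, 6, 8, 35, 33), (18, 25, 7, 9, 36, 34), (19, 26, 8, 10, 37, 35),
  (20, 27, 9, 11, 38, 36), (21, 28, 10, 12, 39, 37), (22, 29, 11, 13, 40, 38), (23, 30, 12, 14, 41, 39),
  (24, 31, 13, 15, 42, 40), (25, 32, 14, 16, 43, 41), (26, 33, 15, 17, 44, 42), (27, 34, 16, 18, 0, 43),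
  (28, 35, 17, 19, 1, 44), (29, 36, 18, 20, 2, 0), (30, 37, 19, 21, 3, 1), (31, 38, 20, 22, 4, 2),
  (32, 39, 21, 23, 5, 3), (33, 40, 22, 24, 6, 4), (34, 41, 23, 25, 7, 5), (35, 42, 24, 26, 8, 6),
  (36, 43, 25, 27, 9, 7), (37, 44, 26, 28, 10, 8), (38, 0, 27, 29, 11, 9), (39, 1, 28, 30, 12, 10),
  (40, 2, 29, 31, 13, 11), (41, 3, 30, 32, 14, 12), (42, 4, 31, 33, 15, 13), (43, 5, 32, 34, 16, 14),
  (44, 6, 33, 35, 17, 15), (0, 3, 11, 44, 37, 4), (1, 4, 12, 0, 38, 5), (2, 5, 13, 1, 39, 6),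
  (3, 6, 14, 2, 40, 7), (4, 7, 15, 3, 41, 8), (5, 8, 16, 4, 42, 9), (6, 9, 17, 5, 43, 10),
  (7, 10, 18, 6, 44, 11), (8, 11, 19, 7, 0, 12), (9, 12, 20, 8, 1, 13), (10, 13, 21, 9, 2, 14),
  (11, 14, 22, 10, 3, 15), (12, 15, 23, 11, 4, 16), (13, 16, 24, 12, 5, 17), (14, 17, 25, 13, 6, 18),
  (15, 18, 26, 14, 7, 19), (16, 19, 27, 15, 8, 20), (17, 20, 28, 16, 9, 21), (18, 21, 29, 17, 10, 22),
  (19, 22, 30, 18, 11, 23), (20, 23, 31, 19, 12, 24), (21, 24, 32, 20, 13, 25), (22, 25, 33, 21, 14, 26),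
  (23, 26, 34, 22, 15, 27), (24, 27, 35, 23, 16, 28), (25, 28, 36, 24, 17, 29), (26, 29, 37, 25, 18, 30),
  (27, 30, 38, 26, 19, 31), (28, 31, 39, 27, 20, 32), (29, 32, 40, 28, 21, 33), (30, 33, 41, 29, 22, 34),
  (31, 34, 42, 30, 23, 35), (32, 35, 43, 31, 24, 36), (33, 36, 44, 32, 25, 37), (34, 37, 0, 33, 26, 38),
  (35, 38, 1, 34, 27, 39), (36, 39, 2, 35, 28, 40), (37, 40, 3, 36, 29, 41), (38, 41, 4, 37, 30, 42),
  (39, 42, 5, 38, 31, 43), (40, 43, 6, 39, 32, 44), (41, 44, 7, 40, 33, 0), (42, 0, 8, 41, 34, 1),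
  (43, 1, 9, 42, 35, 2), (44, 2, 10, 43, 36, 3)]

theorem card_group4 : ∀ i : Fin 4,
    (Finset.univ.filter (fun x : Fin (9 * 4) => x.val % 4 = i.val)).card = 9 := by
  decide +kernel

theorem card_group5 : ∀ i : Fin 5,
    (Finset.univ.filter (fun x : Fin (9 * 5) => x.val % 5 = i.val)).card = 9 := by
  decide +kernel

theorem data4_lt : data4.all (sixLt (9 * 4)) = true := by
  decide +kernel

theorem data4_trans : checkTrans 4 (data4.flatMap blk) = true := by
  decide +kernel

theorem data4_cov : checkCov 4 (9 * 4) (data4.flatMap blk) = true := by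
  decide +kernel

theorem data4_simple : checkSimple (9 * 4) (data4.flatMap blk) = true := by
  decide +kernel

theorem data5_lt : data5.all (sixLt (9 * 5)) = true := by
  decide +kernel

theorem data5_trans : checkTrans 5 (data5.flatMap blk) = true := by
  decide +kernel

theorem data5_cov : checkCov 5 (9 * 5) (data5.flatMap blk) = true := by
  decide +kernel

theorem data5_simple : checkSimple (9 * 5) (data5.flatMap blk) = true := by
  decide +kernel

/-- For every `t ∈ {4,5}` there exists a super-simple `(4,2)`-DGDD of type `9^t` in which every defining set contains at least half of the blocks. -/
theorem exists_superSimple_DGDD_type_nine_pow (t : ℕ) (ht : t ∈ ({4, 5} : Finset ℕ)) :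
    ∃ (groups : Finset (Finset (Fin (9 * t))))
      (D : DGDD (Fin (9 * t)) groups 4 2),
      IsGroupPartition groups ∧ groups.card = t ∧
      (∀ G ∈ groups, G.card = 9) ∧
      D.SuperSimple ∧ D.DefiningHalf := by
  rw [Finset.mem_insert, Finset.mem_singleton] at ht
  rcases ht with rfl | rfl
  · obtain ⟨D, hD⟩ := fromCheck 4 (by norm_num) (data4.map (toFin (9 * 4))) (data4.flatMap blk)
      (toFin_roundtrip _ _ data4_lt) data4_trans data4_cov data4_simple
    refine ⟨resGroups 4, D, resGroups_partition 4 (by norm_num), resGroups_card 4, ?_, hD⟩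
    intro G hG
    obtain ⟨i, -, rfl⟩ := Finset.mem_image.1 hG
    exact card_group4 i
  · obtain ⟨D, hD⟩ := fromCheck 5 (by norm_num) (data5.map (toFin (9 * 5))) (data5.flatMap blk)
      (toFin_roundtrip _ _ data5_lt) data5_trans data5_cov data5_simple
    refine ⟨resGroups 5, D, resGroups_partition 5 (by norm_num), resGroups_card 5, ?_, hD⟩
    intro G hG
    obtain ⟨i, -, rfl⟩ := Finset.mem_image.1 hG
    exact card_group5 i
end

section
/- There exists a super-simple (4,2)-DGDD of type 6^5 in which every defining set contains at least half of the blocks. -/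
namespace SixPowFive

/-- Base blocks, in four pairs; the two blocks of a pair contain a pair of points
adjacently and in opposite orders. -/
def base : Fin 4 → Bool → List (Fin 30)
  | 0, false => [0, 26, 7, 8]
  | 0, true => [24, 26, 0, 22]
  | 1, false => [0, 8, 17, 1]
  | 1, true => [6, 19, 8, 0]
  | 2, false => [0, 17, 16, 14]
  | 2, true => [26, 17, 0, 3]
  | 3, false => [0, 19, 18, 12]
  | 3, true => [12, 18, 21, 9]

/-- The traded base blocks. -/
def traded : Fin 4 → Bool → List (Fin 30)
  | 0, false => [26, 0, 7, 8]
  | 0, true => [24, 0, 26, 22]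
  | 1, false => [8, 0, 17, 1]
  | 1, true => [6, 19, 0, 8]
  | 2, false => [17, 0, 16, 14]
  | 2, true => [26, 0, 17, 3]
  | 3, false => [0, 19, 12, 18]
  | 3, true => [18, 12, 21, 9]

/-- Translate of a block. -/
def shift (i : Fin 30) (b : List (Fin 30)) : List (Fin 30) := b.map (· + i)

/-- The blocks, indexed. -/
def blk (p : (Fin 4 × Bool) × Fin 30) : List (Fin 30) := shift p.2 (base p.1.1 p.1.2)

/-- The traded blocks, indexed. -/
def tblk (p : (Fin 4 × Bool) × Fin 30) : List (Fin 30) := shift p.2 (traded p.1.1 p.1.2)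

/-- The residue classes mod 5. -/
def groups : Finset (Finset (Fin 30)) :=
  Finset.univ.image fun r : Fin 5 => Finset.univ.filter fun x : Fin 30 => x.val % 5 = r.val

/-- All blocks. -/
def blocks : Multiset (List (Fin 30)) := (Finset.univ : Finset ((Fin 4 × Bool) × Fin 30)).val.map blk

theorem sublist_shift (x y i : Fin 30) (b : List (Fin 30)) :
    [x, y].Sublist (shift i b) ↔ [x - i, y - i].Sublist b := by
  have h : [x, y] = List.map (· + i) [x - i, y - i] := by simp
  rw [h, shift]
  refine ⟨fun h => ?_, fun h => h.map _⟩
  have h2 := h.map (· - i)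
  simpa [List.map_map, Function.comp_def, sub_eq_add_neg, add_assoc] using h2

theorem toFinset_shift (i : Fin 30) (b : List (Fin 30)) :
    (shift i b).toFinset = b.toFinset.image (· + i) := by
  ext x
  simp only [shift, List.mem_toFinset, List.mem_map, Finset.mem_image]

theorem inter_base : ∀ p q : Fin 4 × Bool, ∀ k : Fin 30, (p ≠ q ∨ k ≠ 0) →
    ((base p.1 p.2).toFinset ∩ (shift k (base q.1 q.2)).toFinset).card ≤ 2 := by
  decide +kernel

theorem inter_blk (p q : (Fin 4 × Bool) × Fin 30) (h : p ≠ q) :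
    ((blk p).toFinset ∩ (blk q).toFinset).card ≤ 2 := by
  obtain ⟨p, i⟩ := p
  obtain ⟨q, j⟩ := q
  have h1 := inter_base p q (j - i) (by
    by_contra hc
    push Not at hc
    exact h (by rw [hc.1, sub_eq_zero.1 hc.2]))
  have h2 : shift j (base q.1 q.2) = shift i (shift (j - i) (base q.1 q.2)) := by
    simp [shift]
  simp only [blk]
  rw [h2, toFinset_shift i, toFinset_shift i (shift _ _),
    ← Finset.image_inter _ _ (add_left_injective i),
    Finset.card_image_of_injective _ (add_left_injective i)]
  exact h1

theorem card_blk : ∀ p, (blk p).toFinset.card = 4 := by decide +kernel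

theorem blk_injective : Function.Injective blk := by
  intro p q h
  by_contra hne
  have h1 := inter_blk p q hne
  rw [← h, Finset.inter_self, card_blk] at h1
  omega

theorem count_base : ∀ d : Fin 30, d.val % 5 ≠ 0 →
    (Finset.univ.filter fun p : (Fin 4 × Bool) × Fin 30 =>
      [p.2, d + p.2].Sublist (base p.1.1 p.1.2)).card = 2 := by
  decide +kernel

theorem diff_groups (x y : Fin 30) (h : ∀ G ∈ groups, ¬(x ∈ G ∧ y ∈ G)) :
    (y - x).val % 5 ≠ 0 := by
  intro h0
  refine h (Finset.univ.filter fun z : Fin 30 => z.val % 5 = x.val % 5) ?_ ?_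
  · exact Finset.mem_image.2 ⟨⟨x.val % 5, Nat.mod_lt _ (by norm_num)⟩, by simp, rfl⟩
  · simp only [Finset.mem_filter, Finset.mem_univ, true_and]
    rw [Fin.sub_def] at h0
    simp only at h0
    omega

theorem covers_blocks (x y : Fin 30) (h : ∀ G ∈ groups, ¬(x ∈ G ∧ y ∈ G)) :
    blocks.countP (fun b => [x, y].Sublist b) = 2 := by
  rw [← count_base (y - x) (diff_groups x y h), blocks, Multiset.countP_map]
  change (Finset.univ.filter fun p => [x, y].Sublist (blk p)).card = _
  refine Finset.card_bij' (fun p _ => (p.1, x - p.2)) (fun p _ => (p.1, x - p.2)) ?_ ?_ ?_ ?_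
  · intro p hp
    simp only [Finset.mem_filter, Finset.mem_univ, true_and, blk, sublist_shift] at hp ⊢
    convert hp using 3
    abel
  · intro p hp
    simp only [Finset.mem_filter, Finset.mem_univ, true_and, blk, sublist_shift] at hp ⊢
    convert hp using 3
    · abel
    · abel
  · intro p _; simp
  · intro p _; simp

theorem transverse_points : ∀ p, ∀ x ∈ blk p, ∀ y ∈ blk p, x.val % 5 = y.val % 5 → x = y := by
  decide +kernel

theorem transverse_blk : ∀ p, ∀ G ∈ groups, ((blk p).toFinset ∩ G).card ≤ 1 := by
  intro p G hG
  obtain ⟨r, -, rfl⟩ := Finset.mem_image.1 hG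
  refine Finset.card_le_one.2 fun x hx y hy => ?_
  simp only [Finset.mem_inter, List.mem_toFinset, Finset.mem_filter, Finset.mem_univ,
    true_and] at hx hy
  exact transverse_points p x hx.1 y hy.1 (hx.2.trans hy.2.symm)

theorem nodup_blk : ∀ p, (blk p).Nodup := by decide +kernel

theorem length_blk : ∀ p, (blk p).length = 4 := by decide +kernel

theorem perm_base : ∀ p : Fin 4 × Bool, (traded p.1 p.2).Perm (base p.1 p.2) := by decide +kernel

theorem perm_blk (p) : (tblk p).Perm (blk p) := (perm_base p.1).map _

theorem traded_ne : ∀ p, tblk p ≠ blk p := by decide +kernel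

theorem balanced_base : ∀ j : Fin 4, ∀ x y : Fin 30,
    ((if [x, y].Sublist (traded j true) then 1 else 0) +
      if [x, y].Sublist (traded j false) then 1 else 0) =
    ((if [x, y].Sublist (base j true) then 1 else 0) +
      if [x, y].Sublist (base j false) then 1 else 0 : ℕ) := by
  decide +kernel

theorem mem_blocks {b : List (Fin 30)} : b ∈ blocks ↔ ∃ p, blk p = b := by
  simp [blocks]

theorem blocks_nodup : blocks.Nodup := Multiset.Nodup.map blk_injective Finset.univ.nodup

/-- The design. -/
def design : DGDD (Fin 30) groups 4 2 where
  blocks := blocks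
  len b hb := by obtain ⟨p, rfl⟩ := mem_blocks.1 hb; exact length_blk p
  nodup b hb := by obtain ⟨p, rfl⟩ := mem_blocks.1 hb; exact nodup_blk p
  transverse b hb := by obtain ⟨p, rfl⟩ := mem_blocks.1 hb; exact transverse_blk p
  covers x y _ h := covers_blocks x y h

theorem superSimple : design.SuperSimple := by
  refine ⟨blocks_nodup, fun b₁ h₁ b₂ h₂ hne => ?_⟩
  obtain ⟨p, rfl⟩ := mem_blocks.1 h₁
  obtain ⟨q, rfl⟩ := mem_blocks.1 h₂
  exact inter_blk p q fun h => hne (h ▸ rfl)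

theorem tblk_notMem (p) : tblk p ∉ blocks := by
  intro h
  obtain ⟨q, hq⟩ := mem_blocks.1 h
  have hne : q ≠ p := by
    rintro rfl
    exact traded_ne q hq.symm
  have h1 := inter_blk q p hne
  rw [hq, List.toFinset_eq_of_perm _ _ (perm_blk p), Finset.inter_self, card_blk] at h1
  omega

/-- The blocks outside of one trading pair. -/
def rest (j : Fin 4) (i : Fin 30) : Multiset (List (Fin 30)) :=
  (blocks.erase (blk ((j, false), i))).erase (blk ((j, true), i))

theorem blocks_eq (j : Fin 4) (i : Fin 30) :
    blocks = blk ((j, false), i) ::ₘ blk ((j, true), i) ::ₘ rest j i := by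
  have h1 : blk ((j, false), i) ∈ blocks := mem_blocks.2 ⟨_, rfl⟩
  have h2 : blk ((j, true), i) ∈ blocks.erase (blk ((j, false), i)) := by
    refine (Multiset.mem_erase_of_ne ?_).2 (mem_blocks.2 ⟨_, rfl⟩)
    intro h
    simpa using blk_injective h
  rw [rest, Multiset.cons_erase h2, Multiset.cons_erase h1]

/-- The blocks after a trade. -/
def newBlocks (j : Fin 4) (i : Fin 30) : Multiset (List (Fin 30)) :=
  tblk ((j, false), i) ::ₘ tblk ((j, true), i) ::ₘ rest j i

theorem mem_newBlocks {j : Fin 4} {i : Fin 30} {b : List (Fin 30)} (h : b ∈ newBlocks j i) :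
    ∃ p, b.Perm (blk p) := by
  rw [newBlocks, Multiset.mem_cons, Multiset.mem_cons] at h
  rcases h with rfl | rfl | h
  · exact ⟨_, perm_blk _⟩
  · exact ⟨_, perm_blk _⟩
  · obtain ⟨p, rfl⟩ := mem_blocks.1 (Multiset.mem_of_mem_erase (Multiset.mem_of_mem_erase h))
    exact ⟨p, List.Perm.refl _⟩

/-- The design after a trade. -/
def newDesign (j : Fin 4) (i : Fin 30) : DGDD (Fin 30) groups 4 2 where
  blocks := newBlocks j i
  len b hb := by
    obtain ⟨p, hp⟩ := mem_newBlocks hb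
    rw [hp.length_eq, length_blk]
  nodup b hb := by
    obtain ⟨p, hp⟩ := mem_newBlocks hb
    exact hp.nodup_iff.2 (nodup_blk p)
  transverse b hb := by
    obtain ⟨p, hp⟩ := mem_newBlocks hb
    rw [List.toFinset_eq_of_perm _ _ hp]
    exact transverse_blk p
  covers x y _ h := by
    rw [← covers_blocks x y h, blocks_eq j i, newBlocks]
    simp only [Multiset.countP_cons, blk, tblk, sublist_shift]
    have := balanced_base j (x - i) (y - i)
    omega

theorem meets {S : Multiset (List (Fin 30))} (hS : design.IsDefiningSet S) (j : Fin 4)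
    (i : Fin 30) : ∃ c, blk ((j, c), i) ∈ S := by
  by_contra hc
  push Not at hc
  have h1 : S ≤ blocks := hS.1
  rw [blocks_eq j i, Multiset.le_cons_of_notMem (hc false),
    Multiset.le_cons_of_notMem (hc true)] at h1
  have h2 : newBlocks j i = blocks := hS.2 (newDesign j i)
    (h1.trans ((Multiset.le_cons_self _ _).trans (Multiset.le_cons_self _ _)))
  refine tblk_notMem ((j, false), i) ?_
  rw [← h2]
  exact Multiset.mem_cons_self _ _

theorem definingHalf : design.DefiningHalf := by
  intro S hS
  choose c hc using meets hS
  have h1 : (Finset.univ.image fun p : Fin 4 × Fin 30 => blk ((p.1, c p.1 p.2), p.2)).card = 120 := by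
    rw [Finset.card_image_of_injective]
    · simp
    · rintro ⟨a, b⟩ ⟨a', b'⟩ h
      have := blk_injective h
      simp only [Prod.mk.injEq] at this ⊢
      exact ⟨this.1.1, this.2⟩
  have h2 : (Finset.univ.image fun p : Fin 4 × Fin 30 => blk ((p.1, c p.1 p.2), p.2)) ⊆
      S.toFinset := by
    intro b hb
    obtain ⟨p, -, rfl⟩ := Finset.mem_image.1 hb
    exact Multiset.mem_toFinset.2 (hc p.1 p.2)
  have h3 := Finset.card_le_card h2
  have h4 := Multiset.toFinset_card_le S
  have h5 : Multiset.card design.blocks = 240 := by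
    simp [design, blocks]
  omega

theorem partition_groups : IsGroupPartition groups := by
  intro x
  refine ⟨Finset.univ.filter fun z : Fin 30 => z.val % 5 = x.val % 5, ⟨?_, by simp⟩, ?_⟩
  · exact Finset.mem_image.2 ⟨⟨x.val % 5, Nat.mod_lt _ (by norm_num)⟩, by simp, rfl⟩
  · rintro G ⟨hG, hx⟩
    obtain ⟨r, -, rfl⟩ := Finset.mem_image.1 hG
    simp only [Finset.mem_filter, Finset.mem_univ, true_and] at hx
    rw [hx]

theorem group_card : ∀ r : Fin 5,
    (Finset.univ.filter fun x : Fin 30 => x.val % 5 = r.val).card = 6 := by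
  decide +kernel

theorem groups_card : groups.card = 5 := by
  rw [groups, Finset.card_image_of_injective]
  · simp
  · intro r r' h
    have hr : (⟨r.val, by omega⟩ : Fin 30) ∈
        Finset.univ.filter fun x : Fin 30 => x.val % 5 = r.val := by
      simp only [Finset.mem_filter, Finset.mem_univ, true_and]
      omega
    simp only at h
    rw [h] at hr
    simp only [Finset.mem_filter, Finset.mem_univ, true_and] at hr
    ext
    omega

theorem groups_size : ∀ G ∈ groups, G.card = 6 := by
  intro G hG
  obtain ⟨r, -, rfl⟩ := Finset.mem_image.1 hG
  exact group_card r

end SixPowFive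

/-- There exists a super-simple `(4,2)`-DGDD of type `6^5` (5 groups of size 6
on 30 points) in which every defining set contains at least half of the
blocks. -/
theorem exists_superSimple_DGDD_type_six_pow_five :
    ∃ (groups : Finset (Finset (Fin 30)))
      (D : DGDD (Fin 30) groups 4 2),
      IsGroupPartition groups ∧ groups.card = 5 ∧
      (∀ G ∈ groups, G.card = 6) ∧
      D.SuperSimple ∧ D.DefiningHalf := by
  exact ⟨SixPowFive.groups, SixPowFive.design, SixPowFive.partition_groups, SixPowFive.groups_card,
    SixPowFive.groups_size, SixPowFive.superSimple, SixPowFive.definingHalf⟩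
end
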